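/- arXiv:1506.04371 — 7 statements merged into one kernel-verified Lean document; each statement's English description precedes it below -/
import Mathlib

section
/- Let N ≥ 1, 1 < p < ∞ with p ≠ N, and 1 ≤ q ≤ p. Set p* = Np/(N−p) if p < N and p* = ∞ if p > N. For every r with q < r ≤ p* there exists a constant C = C(N,p,q,r) > 0 such that for every smooth function u : ℝ^N → ℝ with compact support, ‖u‖_{L^r(ℝ^N)} ≤ C · ‖u‖_{L^q(ℝ^N)}^{1−θ} · ‖∇u‖_{L^p(ℝ^N)}^{θ}, where θ = (1 − q/r) · Np/(Np + pq − Nq), with the convention q/r = 0 when r = ∞ and ‖u‖_{L^∞} the supremum norm. -/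
open MeasureTheory Real Filter
open scoped ENNReal Topology NNReal

theorem enorm_le_enorm_add_lintegral_fderiv {E : Type*} [NormedAddCommGroup E]
    [NormedSpace ℝ E] {F : Type*} [NormedAddCommGroup F] [NormedSpace ℝ F]
    [CompleteSpace F] {u : E → F} (hu : ContDiff ℝ 1 u) (x w : E) :
    ‖u x‖ₑ ≤ ‖u (x + w)‖ₑ + ∫⁻ t in Set.Ioc (0 : ℝ) 1, ‖fderiv ℝ u (x + t • w)‖ₑ * ‖w‖ₑ := by
  have hd : ∀ t : ℝ, HasDerivAt (fun t : ℝ ↦ u (x + t • w)) (fderiv ℝ u (x + t • w) w) t := by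
    intro t
    have h1 : HasDerivAt (fun t : ℝ ↦ x + t • w) w t := by
      simpa using ((hasDerivAt_id t).smul_const w).const_add x
    exact ((hu.differentiable one_ne_zero) _).hasFDerivAt.comp_hasDerivAt t h1
  have hc : Continuous fun t : ℝ ↦ fderiv ℝ u (x + t • w) w := by
    have := hu.continuous_fderiv one_ne_zero
    fun_prop
  have h := intervalIntegral.integral_eq_sub_of_hasDerivAt (a := 0) (b := 1)
    (fun t _ ↦ hd t) (hc.intervalIntegrable _ _)
  simp only [one_smul, zero_smul, add_zero] at h
  have hx : u x = u (x + w) - ∫ t in (0 : ℝ)..1, fderiv ℝ u (x + t • w) w := by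
    rw [h]; abel
  rw [hx, intervalIntegral.integral_of_le zero_le_one]
  refine enorm_sub_le.trans ?_
  gcongr
  refine (enorm_integral_le_lintegral_enorm _).trans ?_
  gcongr with t
  exact ContinuousLinearMap.le_opENorm _ _

theorem lintegral_rpow_Ioc_ne_top {a : ℝ} (ha : -1 < a) :
    ∫⁻ t in Set.Ioc (0 : ℝ) 1, ENNReal.ofReal (t ^ a) ≠ ∞ := by
  have h := (intervalIntegral.intervalIntegrable_rpow' (a := 0) (b := 1) ha).1
  rw [← ofReal_integral_eq_lintegral_ofReal h]
  · simp
  · exact (ae_restrict_mem measurableSet_Ioc).mono fun t ht ↦ rpow_nonneg ht.1.le _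

/-- The `L^s` integral of a continuous compactly supported function, as a Bochner integral. -/
theorem lintegral_enorm_rpow_eq_ofReal {E : Type*} [NormedAddCommGroup E] [MeasurableSpace E]
    [BorelSpace E] (μ : Measure E) [μ.IsAddHaarMeasure] {F : Type*} [NormedAddCommGroup F] {f : E → F}
    (hf : Continuous f) (h2f : HasCompactSupport f) {s : ℝ} (hs : 0 < s) :
    ∫⁻ z, ‖f z‖ₑ ^ s ∂μ = ENNReal.ofReal (∫ z, ‖f z‖ ^ s ∂μ) := by
  rw [ofReal_integral_eq_lintegral_ofReal]
  · congr with z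
    rw [← ENNReal.ofReal_rpow_of_nonneg (norm_nonneg _) hs.le, ofReal_norm]
  · refine Continuous.integrable_of_hasCompactSupport (by fun_prop (disch := simp [hs.le])) ?_
    exact h2f.norm.comp_left (g := fun y : ℝ ↦ y ^ s) (zero_rpow hs.ne')
  · exact .of_forall fun z ↦ by positivity

section Morrey

variable {E : Type*} [NormedAddCommGroup E] [NormedSpace ℝ E] [MeasurableSpace E] [BorelSpace E]
  [FiniteDimensional ℝ E] (μ : Measure E) [μ.IsAddHaarMeasure]

open Module (finrank)

theorem lintegral_comp_add_smul {g : E → ℝ≥0∞} (hg : Measurable g) (x : E) {s : ℝ} (hs : 0 < s) :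
    ∫⁻ z, g (x + s • z) ∂μ = ENNReal.ofReal (s ^ (-(finrank ℝ E : ℝ))) * ∫⁻ z, g z ∂μ := by
  have h := lintegral_map (μ := μ) (f := fun z ↦ g (x + z)) (g := fun z : E ↦ s • z)
    (by fun_prop) (by fun_prop)
  rw [← h, Measure.map_addHaar_smul μ hs.ne', lintegral_smul_measure, lintegral_add_left_eq_self,
    smul_eq_mul, abs_of_pos (by positivity), rpow_neg hs.le, rpow_natCast]

theorem setLIntegral_comp_add_smul_le {g : E → ℝ≥0∞} (hg : Measurable g) (B : Set E) (x : E)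
    {s p : ℝ} (hs : 0 < s) (hp : 1 ≤ p) :
    ∫⁻ z in B, g (x + s • z) ∂μ ≤ ENNReal.ofReal (s ^ (-((finrank ℝ E : ℝ) / p))) *
      (∫⁻ z, g z ^ p ∂μ) ^ (1 / p) * μ B ^ (1 - 1 / p) := by
  have hp0 : 0 < p := by linarith
  have h := ENNReal.lintegral_mul_norm_pow_le (μ := μ.restrict B)
    (f := fun z ↦ g (x + s • z) ^ p) (g := fun _ ↦ 1) (by fun_prop) (by fun_prop)
    (p := 1 / p) (q := 1 - 1 / p) (by positivity)
    (by rw [sub_nonneg, div_le_one hp0]; exact hp) (by ring)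
  simp only [← ENNReal.rpow_mul, mul_one_div_cancel hp0.ne', ENNReal.rpow_one, ENNReal.one_rpow,
    mul_one, lintegral_one, Measure.restrict_apply_univ] at h
  refine h.trans ?_
  gcongr
  calc (∫⁻ z in B, g (x + s • z) ^ p ∂μ) ^ (1 / p)
      ≤ (∫⁻ z, g (x + s • z) ^ p ∂μ) ^ (1 / p) := by
        gcongr; exact Measure.restrict_le_self
    _ = _ := by
        rw [lintegral_comp_add_smul μ (g := fun z ↦ g z ^ p) (by fun_prop) x hs,
          ENNReal.mul_rpow_of_nonneg _ _ (by positivity),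
          ENNReal.ofReal_rpow_of_nonneg (by positivity) (by positivity), ← rpow_mul hs.le]
        congr 4
        ring

theorem enorm_mul_measure_closedBall_le {F : Type*} [NormedAddCommGroup F] [NormedSpace ℝ F]
    [CompleteSpace F] {u : E → F} (hu : ContDiff ℝ 1 u) {p q : ℝ} (hp : 1 ≤ p) (hq : 1 ≤ q)
    (x : E) {R : ℝ} (hR : 0 < R) :
    ‖u x‖ₑ * μ (Metric.closedBall 0 1) ≤
      ENNReal.ofReal (R ^ (-((finrank ℝ E : ℝ) / q))) * (∫⁻ z, ‖u z‖ₑ ^ q ∂μ) ^ (1 / q) *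
          μ (Metric.closedBall 0 1) ^ (1 - 1 / q) +
        (∫⁻ t in Set.Ioc (0 : ℝ) 1, ENNReal.ofReal (t ^ (-((finrank ℝ E : ℝ) / p)))) *
          (ENNReal.ofReal (R ^ (1 - (finrank ℝ E : ℝ) / p)) *
            (∫⁻ z, ‖fderiv ℝ u z‖ₑ ^ p ∂μ) ^ (1 / p) *
              μ (Metric.closedBall 0 1) ^ (1 - 1 / p)) := by
  set B : Set E := Metric.closedBall 0 1
  have hB : MeasurableSet B := Metric.isClosed_closedBall.measurableSet
  have hcu := hu.continuous
  have hcd := hu.continuous_fderiv one_ne_zero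
  have hm : Measurable fun z ↦ ‖u z‖ₑ := hcu.enorm.measurable
  have hmd : Measurable fun z ↦ ‖fderiv ℝ u z‖ₑ := hcd.enorm.measurable
  calc ‖u x‖ₑ * μ B = ∫⁻ z in B, ‖u x‖ₑ ∂μ := by rw [setLIntegral_const]
    _ ≤ ∫⁻ z in B, (‖u (x + R • z)‖ₑ + ∫⁻ t in Set.Ioc (0 : ℝ) 1,
          ‖fderiv ℝ u (x + (t * R) • z)‖ₑ * ENNReal.ofReal R) ∂μ := by
        refine setLIntegral_mono' hB fun z hz ↦ ?_
        refine (enorm_le_enorm_add_lintegral_fderiv hu x (R • z)).trans ?_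
        simp_rw [smul_smul]
        gcongr
        rw [← ofReal_norm, norm_smul, norm_of_nonneg hR.le]
        refine ENNReal.ofReal_le_ofReal (mul_le_of_le_one_right hR.le ?_)
        simpa [B] using hz
    _ = ∫⁻ z in B, ‖u (x + R • z)‖ₑ ∂μ + ∫⁻ t in Set.Ioc (0 : ℝ) 1,
          (∫⁻ z in B, ‖fderiv ℝ u (x + (t * R) • z)‖ₑ ∂μ) * ENNReal.ofReal R := by
        rw [lintegral_add_left (f := fun z ↦ ‖u (x + R • z)‖ₑ) (hm.comp (by fun_prop)), lintegral_lintegral_swap]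
        · congr 2
          ext t
          rw [lintegral_mul_const' _ _ ENNReal.ofReal_ne_top]
        · refine Measurable.aemeasurable ?_
          refine Measurable.mul_const (hmd.comp ?_) _
          fun_prop
    _ ≤ _ := by
        gcongr ?_ + ?_
        · exact setLIntegral_comp_add_smul_le μ hm B x hR hq
        rw [← lintegral_mul_const _ (by fun_prop)]
        refine setLIntegral_mono' measurableSet_Ioc fun t ht ↦ ?_
        refine (mul_le_mul_left
          (setLIntegral_comp_add_smul_le μ hmd B x (mul_pos ht.1 hR) hp) _).trans_eq ?_
        rw [mul_rpow ht.1.le hR.le, ENNReal.ofReal_mul (rpow_nonneg ht.1.le _),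
          sub_eq_add_neg 1 ((finrank ℝ E : ℝ) / p), rpow_add hR, rpow_one, ENNReal.ofReal_mul hR.le]
        ring

theorem exists_norm_le_rpow_add_rpow (F : Type*) [NormedAddCommGroup F] [NormedSpace ℝ F]
    [CompleteSpace F] {p q : ℝ} (hp : 1 ≤ p) (hq : 1 ≤ q) (hpE : (finrank ℝ E : ℝ) < p) :
    ∃ C : ℝ, 0 < C ∧ ∀ u : E → F, ContDiff ℝ 1 u → HasCompactSupport u → ∀ (x : E) (R : ℝ), 0 < R →
      ‖u x‖ ≤ C * (R ^ (-((finrank ℝ E : ℝ) / q)) * (∫ z, ‖u z‖ ^ q ∂μ) ^ (1 / q) +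
        R ^ (1 - (finrank ℝ E : ℝ) / p) * (∫ z, ‖fderiv ℝ u z‖ ^ p ∂μ) ^ (1 / p)) := by
  set B : Set E := Metric.closedBall 0 1
  have hp0 : 0 < p := by linarith
  have hq0 : 0 < q := by linarith
  have hB0 : μ B ≠ 0 := (Metric.measure_closedBall_pos μ 0 one_pos).ne'
  have hBt : μ B ≠ ∞ := measure_closedBall_lt_top.ne
  have hI : ∫⁻ t in Set.Ioc (0 : ℝ) 1, ENNReal.ofReal (t ^ (-((finrank ℝ E : ℝ) / p))) ≠ ∞ :=
    lintegral_rpow_Ioc_ne_top (by rw [neg_lt_neg_iff, div_lt_one hp0]; exact hpE)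
  have key := fun (u : E → F) (hu : ContDiff ℝ 1 u) ↦
    enorm_mul_measure_closedBall_le μ hu hp hq
  obtain ⟨b, hb⟩ : ∃ b, b = (μ B).toReal := ⟨_, rfl⟩
  obtain ⟨j, hj⟩ : ∃ j, j = (∫⁻ t in Set.Ioc (0 : ℝ) 1,
    ENNReal.ofReal (t ^ (-((finrank ℝ E : ℝ) / p)))).toReal := ⟨_, rfl⟩
  have hb0 : 0 < b := hb ▸ ENNReal.toReal_pos hB0 hBt
  have hj0 : 0 ≤ j := hj ▸ ENNReal.toReal_nonneg
  rw [← ENNReal.ofReal_toReal hI, ← ENNReal.ofReal_toReal hBt, ← hb, ← hj] at key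
  refine ⟨(b ^ (1 - 1 / q) + j * b ^ (1 - 1 / p)) / b, by positivity, fun u hu h2u x R hR ↦ ?_⟩
  have h := key u hu x hR
  set A := ∫ z, ‖u z‖ ^ q ∂μ
  set D := ∫ z, ‖fderiv ℝ u z‖ ^ p ∂μ
  have hA : 0 ≤ A := integral_nonneg fun _ ↦ by positivity
  have hD : 0 ≤ D := integral_nonneg fun _ ↦ by positivity
  rw [lintegral_enorm_rpow_eq_ofReal μ hu.continuous h2u hq0,
    lintegral_enorm_rpow_eq_ofReal μ (hu.continuous_fderiv one_ne_zero) (h2u.fderiv ℝ) hp0,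
    ENNReal.ofReal_rpow_of_nonneg hA (by positivity),
    ENNReal.ofReal_rpow_of_nonneg hD (by positivity), ENNReal.ofReal_rpow_of_pos hb0,
    ENNReal.ofReal_rpow_of_pos hb0, ← ofReal_norm, ← ENNReal.ofReal_mul (by positivity),
    ← ENNReal.ofReal_mul (by positivity), ← ENNReal.ofReal_mul (by positivity),
    ← ENNReal.ofReal_mul (by positivity), ← ENNReal.ofReal_mul (by positivity),
    ← ENNReal.ofReal_mul (by positivity), ← ENNReal.ofReal_add (by positivity) (by positivity),
    ENNReal.ofReal_le_ofReal_iff (by positivity)] at h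
  rw [div_mul_eq_mul_div, le_div_iff₀ hb0]
  refine h.trans (sub_nonneg.1 ?_)
  have : 0 ≤ j * b ^ (1 - 1 / p) * (R ^ (-((finrank ℝ E : ℝ) / q)) * A ^ (1 / q)) +
    b ^ (1 - 1 / q) * (R ^ (1 - (finrank ℝ E : ℝ) / p) * D ^ (1 / p)) := by positivity
  linarith

end Morrey

theorem le_mul_rpow_mul_rpow_of_forall_le {s C a b α β : ℝ} (hC : 0 ≤ C) (ha : 0 ≤ a) (hb : 0 ≤ b)
    (hα : 0 < α) (hβ : 0 < β)
    (h : ∀ R : ℝ, 0 < R → s ≤ C * (R ^ (-α) * a + R ^ β * b)) :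
    s ≤ 2 * C * a ^ (1 - α / (α + β)) * b ^ (α / (α + β)) := by
  have h1 : 1 - α / (α + β) = β / (α + β) := by field_simp; ring
  have key : ∀ ε : ℝ, 0 < ε →
      s ≤ 2 * C * (a + ε) ^ (1 - α / (α + β)) * (b + ε) ^ (α / (α + β)) := by
    intro ε hε
    have ha' : 0 < a + ε := by positivity
    have hb' : 0 < b + ε := by positivity
    set R := ((a + ε) / (b + ε)) ^ (1 / (α + β)) with hR
    have hR0 : 0 < R := by positivity
    have e1 : R ^ (-α) * (a + ε) = (a + ε) ^ (1 - α / (α + β)) * (b + ε) ^ (α / (α + β)) := by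
      rw [hR, ← rpow_mul (by positivity), div_rpow ha'.le hb'.le,
        show 1 / (α + β) * -α = -(α / (α + β)) by ring, rpow_neg ha'.le, rpow_neg hb'.le,
        rpow_sub ha', rpow_one]
      field_simp
    have e2 : R ^ β * (b + ε) = (a + ε) ^ (1 - α / (α + β)) * (b + ε) ^ (α / (α + β)) := by
      rw [hR, ← rpow_mul (by positivity), div_rpow ha'.le hb'.le,
        show α / (α + β) = 1 - β / (α + β) by field_simp; ring,
        show 1 / (α + β) * β = β / (α + β) by ring, rpow_sub hb', rpow_one, sub_sub_cancel]
      field_simp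
    calc s ≤ C * (R ^ (-α) * a + R ^ β * b) := h R hR0
      _ ≤ C * (R ^ (-α) * (a + ε) + R ^ β * (b + ε)) := by gcongr <;> linarith
      _ = _ := by rw [e1, e2]; ring
  have hl : Tendsto (fun ε : ℝ ↦
      2 * C * (a + ε) ^ (1 - α / (α + β)) * (b + ε) ^ (α / (α + β))) (𝓝[>] 0)
      (𝓝 (2 * C * (a + 0) ^ (1 - α / (α + β)) * (b + 0) ^ (α / (α + β)))) := by
    refine Tendsto.mono_left (Continuous.tendsto ?_ 0) nhdsWithin_le_nhds
    have h2 : 0 ≤ 1 - α / (α + β) := by rw [h1]; positivity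
    have h3 : 0 ≤ α / (α + β) := by positivity
    fun_prop (disch := simp [*])
  simp only [add_zero] at hl
  exact ge_of_tendsto hl (eventually_mem_nhdsWithin.mono key)

theorem integral_rpow_le_rpow_mul_rpow {E : Type*} [NormedAddCommGroup E] [MeasurableSpace E]
    [BorelSpace E] (μ : Measure E) [μ.IsAddHaarMeasure]
    {f : E → ℝ} (hf : Continuous f) (h2f : HasCompactSupport f) {s t a b : ℝ} (hs : 0 < s)
    (ht : 0 < t) (ha : 0 ≤ a) (hb : 0 ≤ b) (hab : a + b = 1) :
    ∫ z, ‖f z‖ ^ (s * a + t * b) ∂μ ≤ (∫ z, ‖f z‖ ^ s ∂μ) ^ a * (∫ z, ‖f z‖ ^ t ∂μ) ^ b := by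
  have hr : 0 < s * a + t * b := by
    rcases ha.eq_or_lt with rfl | ha
    · obtain rfl : b = 1 := by linarith
      simpa
    · positivity
  have h := ENNReal.lintegral_mul_norm_pow_le (μ := μ) (f := fun z ↦ ‖f z‖ₑ ^ s)
    (g := fun z ↦ ‖f z‖ₑ ^ t) (by fun_prop) (by fun_prop) ha hb hab
  simp only [← ENNReal.rpow_mul] at h
  simp_rw [← ENNReal.rpow_add_of_nonneg _ _ (mul_nonneg hs.le ha) (mul_nonneg ht.le hb)] at h
  have hS : 0 ≤ ∫ z, ‖f z‖ ^ s ∂μ := integral_nonneg fun _ ↦ by positivity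
  have hT : 0 ≤ ∫ z, ‖f z‖ ^ t ∂μ := integral_nonneg fun _ ↦ by positivity
  rwa [lintegral_enorm_rpow_eq_ofReal μ hf h2f hr, lintegral_enorm_rpow_eq_ofReal μ hf h2f hs,
    lintegral_enorm_rpow_eq_ofReal μ hf h2f ht, ENNReal.ofReal_rpow_of_nonneg hS ha,
    ENNReal.ofReal_rpow_of_nonneg hT hb, ← ENNReal.ofReal_mul (by positivity),
    ENNReal.ofReal_le_ofReal_iff (by positivity)] at h

theorem exists_Lp_norm_le_Lp_norm_fderiv {E : Type*} [NormedAddCommGroup E] [NormedSpace ℝ E]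
    [MeasurableSpace E] [BorelSpace E] [FiniteDimensional ℝ E] (μ : Measure E)
    [μ.IsAddHaarMeasure] {p t : ℝ} (hp : 1 ≤ p) (ht : 0 < t)
    (hE : 0 < Module.finrank ℝ E) (hpt : t⁻¹ = p⁻¹ - (Module.finrank ℝ E : ℝ)⁻¹) :
    ∃ C : ℝ, 0 ≤ C ∧ ∀ u : E → ℝ, ContDiff ℝ 1 u → HasCompactSupport u →
      (∫ z, ‖u z‖ ^ t ∂μ) ^ (1 / t) ≤ C * (∫ z, ‖fderiv ℝ u z‖ ^ p ∂μ) ^ (1 / p) := by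
  have hp0 : 0 < p := by linarith
  lift p to ℝ≥0 using hp0.le
  lift t to ℝ≥0 using ht.le
  refine ⟨eLpNormLESNormFDerivOfEqInnerConst μ p, NNReal.coe_nonneg _, fun u hu h2u ↦ ?_⟩
  have h := eLpNorm_le_eLpNorm_fderiv_of_eq_inner μ hu h2u (p := p) (p' := t)
    (by exact_mod_cast hp) hE (by exact_mod_cast hpt)
  have hT : 0 ≤ ∫ z, ‖u z‖ ^ (t : ℝ) ∂μ := integral_nonneg fun _ ↦ by positivity
  have hP : 0 ≤ ∫ z, ‖fderiv ℝ u z‖ ^ (p : ℝ) ∂μ := integral_nonneg fun _ ↦ by positivity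
  rw [eLpNorm_eq_lintegral_rpow_enorm_toReal (by simpa using ht.ne') (by simp),
    eLpNorm_eq_lintegral_rpow_enorm_toReal (by simpa using hp0.ne') (by simp),
    ENNReal.coe_toReal, ENNReal.coe_toReal, lintegral_enorm_rpow_eq_ofReal μ hu.continuous h2u ht,
    lintegral_enorm_rpow_eq_ofReal μ (hu.continuous_fderiv one_ne_zero) (h2u.fderiv ℝ) hp0,
    ENNReal.ofReal_rpow_of_nonneg hT (by positivity),
    ENNReal.ofReal_rpow_of_nonneg hP (by positivity), ← ENNReal.ofReal_coe_nnreal,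
    ← ENNReal.ofReal_mul (by positivity), ENNReal.ofReal_le_ofReal_iff (by positivity)] at h
  exact h

/-- The supremum-norm Gagliardo–Nirenberg inequality above the critical exponent. -/
theorem exists_norm_le_rpow_mul_rpow {E : Type*} [NormedAddCommGroup E] [NormedSpace ℝ E]
    [MeasurableSpace E] [BorelSpace E] [FiniteDimensional ℝ E] (μ : Measure E)
    [μ.IsAddHaarMeasure] (F : Type*) [NormedAddCommGroup F] [NormedSpace ℝ F]
    [CompleteSpace F] {p q θ : ℝ} (hp : 1 ≤ p) (hq : 1 ≤ q) (hE : 0 < Module.finrank ℝ E)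
    (hpE : (Module.finrank ℝ E : ℝ) < p)
    (hθ : θ = (Module.finrank ℝ E : ℝ) * p /
      ((Module.finrank ℝ E : ℝ) * p + p * q - (Module.finrank ℝ E : ℝ) * q)) :
    ∃ C : ℝ, 0 < C ∧ ∀ u : E → F, ContDiff ℝ 1 u → HasCompactSupport u → ∀ x : E,
      ‖u x‖ ≤ C * ((∫ z, ‖u z‖ ^ q ∂μ) ^ (1 / q)) ^ (1 - θ) *
        ((∫ z, ‖fderiv ℝ u z‖ ^ p ∂μ) ^ (1 / p)) ^ θ := by
  obtain ⟨C, hC, h⟩ := exists_norm_le_rpow_add_rpow μ F hp hq hpE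
  set n : ℝ := (Module.finrank ℝ E : ℝ)
  have hn : 0 < n := by simpa [n] using hE
  have hp0 : 0 < p := by linarith
  have hq0 : 0 < q := by linarith
  have hβ : 0 < 1 - n / p := by rw [sub_pos, div_lt_one hp0]; exact hpE
  refine ⟨2 * C, by positivity, fun u hu h2u x ↦ ?_⟩
  have hd : 0 < n * p + p * q - n * q := by
    have := mul_pos (sub_pos.2 hpE) hq0
    nlinarith [mul_pos hn hp0]
  have hθ' : θ = n / q / (n / q + (1 - n / p)) := by
    rw [hθ, div_eq_div_iff hd.ne' (by positivity)]
    field_simp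
    ring
  rw [hθ']
  exact le_mul_rpow_mul_rpow_of_forall_le hC.le
    (rpow_nonneg (integral_nonneg fun _ ↦ by positivity) _)
    (rpow_nonneg (integral_nonneg fun _ ↦ by positivity) _)
    (by positivity) hβ (fun R hR ↦ h u hu h2u x R hR)

/-- **Gagliardo–Nirenberg interpolation inequalities, case `p ≠ N`**
(Proposition 2.5, inequality (2.3)). For `1 ≤ q ≤ p`, `p ≠ N` and `q < r ≤ p*`
(where `p* = Np/(N-p)` if `p < N` and `p* = ∞` if `p > N`),
`‖u‖_{L^r} ≤ C ‖u‖_{L^q}^{1-θ} ‖∇u‖_{L^p}^{θ}` with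
`θ = (1 - q/r)·Np/(Np + pq - Nq)`. The case `r = ∞` (only possible when `p > N`)
is stated separately with the supremum norm and `θ = Np/(Np + pq - Nq)`. -/
theorem gagliardo_nirenberg_non_conformal
    (N : ℕ) (hN : 1 ≤ N) (p q : ℝ) (hp : 1 < p) (hpN : p ≠ (N : ℝ))
    (hq : 1 ≤ q) (hqp : q ≤ p) :
    (∀ r : ℝ, q < r → (p < (N : ℝ) → r ≤ (N : ℝ) * p / ((N : ℝ) - p)) →
      ∃ C : ℝ, 0 < C ∧ ∀ u : EuclideanSpace ℝ (Fin N) → ℝ,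
        ContDiff ℝ (⊤ : ℕ∞) u → HasCompactSupport u →
        (∫ x, |u x| ^ r) ^ (1 / r) ≤
          C * ((∫ x, |u x| ^ q) ^ (1 / q)) ^
                (1 - (1 - q / r) * ((N : ℝ) * p / ((N : ℝ) * p + p * q - (N : ℝ) * q)))
            * ((∫ x, ‖gradient u x‖ ^ p) ^ (1 / p)) ^
                ((1 - q / r) * ((N : ℝ) * p / ((N : ℝ) * p + p * q - (N : ℝ) * q))))
    ∧ ((N : ℝ) < p →
      ∃ C : ℝ, 0 < C ∧ ∀ u : EuclideanSpace ℝ (Fin N) → ℝ,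
        ContDiff ℝ (⊤ : ℕ∞) u → HasCompactSupport u →
        (⨆ x, |u x|) ≤
          C * ((∫ x, |u x| ^ q) ^ (1 / q)) ^
                (1 - (N : ℝ) * p / ((N : ℝ) * p + p * q - (N : ℝ) * q))
            * ((∫ x, ‖gradient u x‖ ^ p) ^ (1 / p)) ^
                ((N : ℝ) * p / ((N : ℝ) * p + p * q - (N : ℝ) * q))) := by
  have hn : (0 : ℝ) < N := by exact_mod_cast hN
  have hp0 : 0 < p := by linarith
  have hq0 : 0 < q := by linarith
  have hgrad : ∀ (u : EuclideanSpace ℝ (Fin N) → ℝ) x, ‖gradient u x‖ = ‖fderiv ℝ u x‖ :=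
    fun u x ↦ by simp [gradient]
  simp only [hgrad, ← Real.norm_eq_abs]
  have hfr : Module.finrank ℝ (EuclideanSpace ℝ (Fin N)) = N := by simp
  have hsup := fun h : (N : ℝ) < p ↦ exists_norm_le_rpow_mul_rpow
    (volume : Measure (EuclideanSpace ℝ (Fin N))) ℝ hp.le hq (by rw [hfr]; exact hN)
    (by simpa using h) rfl
  simp only [hfr] at hsup
  have hd : 0 < (N : ℝ) * p + p * q - N * q := by
    nlinarith [mul_pos hp0 hq0, mul_nonneg hn.le (sub_nonneg.2 hqp)]
  constructor
  · intro r hr hrp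
    have hr0 : 0 < r := by linarith
    rcases lt_or_gt_of_ne hpN with hlt | hgt
    · have hnp : 0 < (N : ℝ) - p := by linarith
      obtain ⟨t, ht⟩ : ∃ t, t = (N : ℝ) * p / (N - p) := ⟨_, rfl⟩
      have ht0 : 0 < t := ht ▸ by positivity
      have hrt : r ≤ t := ht ▸ hrp hlt
      have hqt : q < t := hr.trans_le hrt
      obtain ⟨C, hC, h⟩ := exists_Lp_norm_le_Lp_norm_fderiv
        (volume : Measure (EuclideanSpace ℝ (Fin N))) hp.le ht0 (by rw [hfr]; exact hN)
        (by rw [hfr, ht]; field_simp)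
      obtain ⟨θ, hθ⟩ : ∃ θ, θ = (1 - q / r) * ((N : ℝ) * p / (N * p + p * q - N * q)) := ⟨_, rfl⟩
      rw [← hθ]
      have hqt0 : t - q ≠ 0 := by linarith
      have hθ' : θ = (r - q) / (t - q) * t / r := by
        have : (N : ℝ) * p / (N * p + p * q - N * q) = t / (t - q) := by
          rw [div_eq_div_iff hd.ne' hqt0, ht]
          field_simp
          ring
        rw [hθ, this]
        field_simp
      have hθ1 : 1 - θ = (t - r) / (t - q) * q / r := by
        rw [hθ']
        field_simp
        ring
      have hθ0 : 0 ≤ θ := by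
        rw [hθ']
        have : 0 < r - q := by linarith
        have : 0 < t - q := by linarith
        positivity
      refine ⟨C ^ θ + 1, by positivity, fun u hu h2u ↦ ?_⟩
      have hu1 : ContDiff ℝ 1 u := hu.of_le (by exact_mod_cast le_top)
      have hi := integral_rpow_le_rpow_mul_rpow (volume : Measure (EuclideanSpace ℝ (Fin N)))
        hu.continuous h2u hq0 ht0 (a := (t - r) / (t - q)) (b := (r - q) / (t - q))
        (div_nonneg (by linarith) (by linarith)) (div_nonneg (by linarith) (by linarith))
        (by field_simp; ring)
      rw [show q * ((t - r) / (t - q)) + t * ((r - q) / (t - q)) = r by field_simp; ring] at hi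
      have hs := h u hu1 h2u
      have h0 : ∀ s : ℝ, 0 ≤ ∫ z, ‖u z‖ ^ s := fun s ↦ integral_nonneg fun _ ↦ by positivity
      have hD : 0 ≤ ∫ z, ‖fderiv ℝ u z‖ ^ p := integral_nonneg fun _ ↦ by positivity
      have hq' := h0 q
      have ht' := h0 t
      calc (∫ z, ‖u z‖ ^ r) ^ (1 / r)
          ≤ ((∫ z, ‖u z‖ ^ q) ^ ((t - r) / (t - q)) *
              (∫ z, ‖u z‖ ^ t) ^ ((r - q) / (t - q))) ^ (1 / r) :=
            rpow_le_rpow (h0 r) hi (by positivity)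
        _ = ((∫ z, ‖u z‖ ^ q) ^ (1 / q)) ^ (1 - θ) * ((∫ z, ‖u z‖ ^ t) ^ (1 / t)) ^ θ := by
            rw [mul_rpow (by positivity) (by positivity), ← rpow_mul hq', ← rpow_mul ht',
              ← rpow_mul hq', ← rpow_mul ht', hθ1, hθ']
            congr 2 <;> field_simp
        _ ≤ ((∫ z, ‖u z‖ ^ q) ^ (1 / q)) ^ (1 - θ) *
              (C * (∫ z, ‖fderiv ℝ u z‖ ^ p) ^ (1 / p)) ^ θ := by gcongr
        _ = C ^ θ * ((∫ z, ‖u z‖ ^ q) ^ (1 / q)) ^ (1 - θ) *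
              ((∫ z, ‖fderiv ℝ u z‖ ^ p) ^ (1 / p)) ^ θ := by
            rw [mul_rpow hC (by positivity)]
            ring
        _ ≤ _ := by gcongr; linarith
    · obtain ⟨C, hC, h⟩ := hsup hgt
      obtain ⟨θ, hθ⟩ : ∃ θ, θ = (N : ℝ) * p / (N * p + p * q - N * q) := ⟨_, rfl⟩
      rw [← hθ] at h ⊢
      have hqr : 0 ≤ 1 - q / r := by rw [sub_nonneg, div_le_one hr0]; exact hr.le
      refine ⟨C ^ (1 - q / r), by positivity, fun u hu h2u ↦ ?_⟩
      have hu1 : ContDiff ℝ 1 u := hu.of_le (by exact_mod_cast le_top)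
      obtain ⟨A, hA⟩ : ∃ A, A = (∫ z, ‖u z‖ ^ q) ^ (1 / q) := ⟨_, rfl⟩
      obtain ⟨D, hD⟩ : ∃ D, D = (∫ z, ‖fderiv ℝ u z‖ ^ p) ^ (1 / p) := ⟨_, rfl⟩
      have hs := h u hu1 h2u
      rw [← hA, ← hD] at hs ⊢
      have hI0 : 0 ≤ ∫ z, ‖u z‖ ^ q := integral_nonneg fun _ ↦ by positivity
      have hA0 : 0 ≤ A := hA ▸ by positivity
      have hD0 : 0 ≤ D := hD ▸ rpow_nonneg (integral_nonneg fun _ ↦ by positivity) _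
      have hAI : ∫ z, ‖u z‖ ^ q = A ^ q := by
        rw [hA, ← rpow_mul hI0, one_div_mul_cancel hq0.ne', rpow_one]
      obtain ⟨M, hM⟩ : ∃ M, M = C * A ^ (1 - θ) * D ^ θ := ⟨_, rfl⟩
      have hM0 : 0 ≤ M := hM ▸ by positivity
      rw [← hM] at hs
      have hint : ∀ s : ℝ, 0 < s → Integrable fun z ↦ ‖u z‖ ^ s := fun s hs ↦
        (hu.continuous.norm.rpow_const fun _ ↦ .inr hs.le).integrable_of_hasCompactSupport
          (h2u.norm.comp_left (g := fun y : ℝ ↦ y ^ s) (zero_rpow hs.ne'))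
      have hi : ∫ z, ‖u z‖ ^ r ≤ M ^ (r - q) * A ^ q := by
        rw [← hAI, ← integral_const_mul]
        refine integral_mono (hint r hr0) ((hint q hq0).const_mul _) fun z ↦ ?_
        calc ‖u z‖ ^ r = ‖u z‖ ^ (r - q) * ‖u z‖ ^ q := by
              rw [← rpow_add_of_nonneg (norm_nonneg _) (by linarith) hq0.le, sub_add_cancel]
          _ ≤ M ^ (r - q) * ‖u z‖ ^ q := by
              refine mul_le_mul_of_nonneg_right ?_ (by positivity)
              exact rpow_le_rpow (norm_nonneg _) (hs z) (by linarith)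
      have hθ1 : 0 ≤ 1 - θ := by
        rw [hθ, sub_nonneg, div_le_one hd]
        nlinarith
      calc (∫ z, ‖u z‖ ^ r) ^ (1 / r) ≤ (M ^ (r - q) * A ^ q) ^ (1 / r) :=
            rpow_le_rpow (integral_nonneg fun _ ↦ by positivity) hi (by positivity)
        _ = M ^ (1 - q / r) * A ^ (q / r) := by
            rw [mul_rpow (by positivity) (by positivity), ← rpow_mul hM0, ← rpow_mul hA0]
            congr 2 <;> field_simp
        _ = C ^ (1 - q / r) * (A ^ ((1 - θ) * (1 - q / r)) * A ^ (q / r)) *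
              D ^ ((1 - q / r) * θ) := by
            rw [hM, mul_rpow (by positivity) (by positivity), mul_rpow hC.le (by positivity),
              ← rpow_mul hA0, ← rpow_mul hD0, mul_comm θ]
            ring
        _ = _ := by
            rw [← rpow_add_of_nonneg hA0 (by positivity) (by positivity)]
            congr 3
            ring
  · intro hgt
    obtain ⟨C, hC, h⟩ := hsup hgt
    exact ⟨C, hC, fun u hu h2u ↦ ciSup_le fun x ↦
      h u (hu.of_le (by exact_mod_cast le_top)) h2u x⟩
end

section
/- Let N ≥ 2, p = N, and 1 ≤ q ≤ N. For every r with q < r < ∞ there exists a constant C = C(N,q,r) > 0 such that for every smooth function u : ℝ^N → ℝ with compact support, ( ∫_{ℝ^N} |u|^r dx )^{1/r} ≤ C · ( ∫_{ℝ^N} |∇u|^N dx )^{(r−q)/(N r)} · ( ∫_{ℝ^N} |u|^q dx )^{1/r}. -/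
open MeasureTheory Real Filter
open scoped ENNReal Topology NNReal

theorem Continuous.lintegral_enorm_rpow_eq_ofReal_integral {E G : Type*}
    [TopologicalSpace E] [MeasurableSpace E] [OpensMeasurableSpace E] {μ : Measure E}
    [IsFiniteMeasureOnCompacts μ] [NormedAddCommGroup G] {f : E → G}
    (hf : Continuous f) (h2f : HasCompactSupport f) {s : ℝ} (hs : 0 < s) :
    ∫⁻ x, ‖f x‖ₑ ^ s ∂μ = ENNReal.ofReal (∫ x, ‖f x‖ ^ s ∂μ) := by
  have h_int : Integrable (fun x ↦ ‖f x‖ ^ s) μ :=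
    (hf.norm.rpow_const fun _ ↦ .inr hs.le).integrable_of_hasCompactSupport
      (h2f.norm.rpow_const hs.ne')
  rw [ofReal_integral_eq_lintegral_ofReal h_int (.of_forall fun x ↦ by positivity)]
  refine lintegral_congr fun x ↦ ?_
  rw [← ENNReal.ofReal_rpow_of_nonneg (norm_nonneg _) hs.le, ofReal_norm]

section GagliardoNirenberg

variable {E : Type*} [NormedAddCommGroup E] [NormedSpace ℝ E] [FiniteDimensional ℝ E]
  [MeasurableSpace E] [BorelSpace E] (μ : Measure E) [μ.IsAddHaarMeasure]
  {F : Type*} [NormedAddCommGroup F] [InnerProductSpace ℝ F]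

/-- Applying the `L¹` Gagliardo–Nirenberg–Sobolev inequality to a power of `‖u‖` raises the
exponent of integrability by the conjugate exponent of the dimension. -/
theorem exists_lintegral_rpow_add_conjExponent_le {p s : ℝ}
    (hp : Real.HolderConjugate (Module.finrank ℝ E) p) (hs : 0 < s) :
    ∃ C : ℝ≥0, ∀ u : E → F, ContDiff ℝ 1 u → HasCompactSupport u →
      ∫⁻ x, ‖u x‖ₑ ^ (s + p) ∂μ ≤
        C * (∫⁻ x, ‖fderiv ℝ u x‖ₑ ^ (Module.finrank ℝ E : ℝ) ∂μ) ^ (p / Module.finrank ℝ E)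
          * ∫⁻ x, ‖u x‖ₑ ^ s ∂μ := by
  set n := Module.finrank ℝ E
  have hp0 : 0 < p := hp.symm.pos
  let γ : ℝ≥0 := ⟨s / p + 1, by positivity⟩
  have hγ : (γ : ℝ) = s / p + 1 := rfl
  have hγ_pos : (0 : ℝ) < γ := by rw [hγ]; positivity
  have h_one_lt : 1 < (γ : ℝ) := by rw [hγ]; linarith [div_pos hs hp0]
  have h_mul : (γ : ℝ) * p = s + p := by rw [hγ]; field_simp
  have h_sub_mul : ((γ : ℝ) - 1) * p = s := by rw [hγ]; field_simp; ring
  refine ⟨lintegralPowLePowLIntegralFDerivConst μ p * γ ^ p, fun u hu h2u ↦ ?_⟩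
  have hu_cont := hu.continuous
  have hdu_cont := hu.continuous_fderiv one_ne_zero
  have hv : ContDiff ℝ 1 (fun x ↦ ‖u x‖ ^ (γ : ℝ)) := hu.norm_rpow h_one_lt
  have h2v : HasCompactSupport (fun x ↦ ‖u x‖ ^ (γ : ℝ)) := h2u.norm.rpow_const hγ_pos.ne'
  have h_grad : ∫⁻ x, ‖fderiv ℝ (fun x ↦ ‖u x‖ ^ (γ : ℝ)) x‖ₑ ∂μ ≤
      γ * ((∫⁻ x, ‖fderiv ℝ u x‖ₑ ^ (n : ℝ) ∂μ) ^ (1 / (n : ℝ)) *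
        (∫⁻ x, ‖u x‖ₑ ^ s ∂μ) ^ (1 / p)) := by
    calc ∫⁻ x, ‖fderiv ℝ (fun x ↦ ‖u x‖ ^ (γ : ℝ)) x‖ₑ ∂μ
        ≤ ∫⁻ x, γ * (‖fderiv ℝ u x‖ₑ * ‖u x‖ₑ ^ ((γ : ℝ) - 1)) ∂μ := by
          refine lintegral_mono fun x ↦ ?_
          refine (enorm_fderiv_norm_rpow_le (hu.differentiable one_ne_zero) h_one_lt).trans_eq ?_
          ring
      _ = γ * ∫⁻ x, ‖fderiv ℝ u x‖ₑ * ‖u x‖ₑ ^ ((γ : ℝ) - 1) ∂μ :=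
          lintegral_const_mul' _ _ ENNReal.coe_ne_top
      _ ≤ _ := by
          gcongr
          have := ENNReal.lintegral_mul_le_Lp_mul_Lq μ hp
            (f := fun x ↦ ‖fderiv ℝ u x‖ₑ) (g := fun x ↦ ‖u x‖ₑ ^ ((γ : ℝ) - 1))
            hdu_cont.enorm.measurable.aemeasurable
            (hu_cont.enorm.measurable.pow_const _).aemeasurable
          simpa only [← ENNReal.rpow_mul, h_sub_mul, Pi.mul_apply] using this
  calc ∫⁻ x, ‖u x‖ₑ ^ (s + p) ∂μ
      = ∫⁻ x, ‖‖u x‖ ^ (γ : ℝ)‖ₑ ^ p ∂μ := by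
        simp_rw [Real.enorm_rpow_of_nonneg (norm_nonneg _) hγ_pos.le, enorm_norm,
          ← ENNReal.rpow_mul, h_mul]
    _ ≤ lintegralPowLePowLIntegralFDerivConst μ p *
          (∫⁻ x, ‖fderiv ℝ (fun x ↦ ‖u x‖ ^ (γ : ℝ)) x‖ₑ ∂μ) ^ p :=
        lintegral_pow_le_pow_lintegral_fderiv μ hv h2v hp
    _ ≤ lintegralPowLePowLIntegralFDerivConst μ p *
          (γ * ((∫⁻ x, ‖fderiv ℝ u x‖ₑ ^ (n : ℝ) ∂μ) ^ (1 / (n : ℝ)) *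
            (∫⁻ x, ‖u x‖ₑ ^ s ∂μ) ^ (1 / p))) ^ p := by gcongr
    _ = _ := by
        rw [ENNReal.mul_rpow_of_nonneg _ _ hp0.le, ENNReal.mul_rpow_of_nonneg _ _ hp0.le,
          ← ENNReal.rpow_mul, ← ENNReal.rpow_mul, one_div_mul_cancel hp0.ne', ENNReal.rpow_one,
          ENNReal.coe_mul, ENNReal.coe_rpow_of_nonneg _ hp0.le, one_div_mul_eq_div]
        ring

theorem exists_lintegral_rpow_add_nat_mul_conjExponent_le {p s : ℝ}
    (hp : Real.HolderConjugate (Module.finrank ℝ E) p) (hs : 0 < s) (k : ℕ) :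
    ∃ C : ℝ≥0, ∀ u : E → F, ContDiff ℝ 1 u → HasCompactSupport u →
      ∫⁻ x, ‖u x‖ₑ ^ (s + k * p) ∂μ ≤
        C * (∫⁻ x, ‖fderiv ℝ u x‖ₑ ^ (Module.finrank ℝ E : ℝ) ∂μ) ^
            (k * p / Module.finrank ℝ E)
          * ∫⁻ x, ‖u x‖ₑ ^ s ∂μ := by
  have hp0 : 0 < p := hp.symm.pos
  induction k with
  | zero => exact ⟨1, fun u _ _ ↦ by simp⟩
  | succ k ih =>
    obtain ⟨C₁, h₁⟩ := ih
    obtain ⟨C₂, h₂⟩ := exists_lintegral_rpow_add_conjExponent_le (F := F) μ hp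
      (s := s + k * p) (by positivity)
    refine ⟨C₂ * C₁, fun u hu h2u ↦ ?_⟩
    have h_exp : s + ((k + 1 : ℕ) : ℝ) * p = s + k * p + p := by push_cast; ring
    have h_exp' : ((k + 1 : ℕ) : ℝ) * p / Module.finrank ℝ E =
        p / Module.finrank ℝ E + k * p / Module.finrank ℝ E := by push_cast; ring
    rw [h_exp, h_exp', ENNReal.rpow_add_of_nonneg _ _ (by positivity) (by positivity)]
    refine (h₂ u hu h2u).trans ((mul_le_mul_right (h₁ u hu h2u) _).trans_eq ?_)
    push_cast
    ring

/-- The **Gagliardo–Nirenberg interpolation inequality** in the conformal case, where the gradient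
is measured in `Lⁿ` with `n` the dimension. -/
theorem exists_lintegral_rpow_le_lintegral_fderiv_mul_lintegral_rpow {q r : ℝ}
    (hn : 2 ≤ Module.finrank ℝ E) (hq : 0 < q) (hqr : q < r) :
    ∃ C : ℝ≥0, ∀ u : E → F, ContDiff ℝ 1 u → HasCompactSupport u →
      ∫⁻ x, ‖u x‖ₑ ^ r ∂μ ≤
        C * (∫⁻ x, ‖fderiv ℝ u x‖ₑ ^ (Module.finrank ℝ E : ℝ) ∂μ) ^
            ((r - q) / Module.finrank ℝ E)
          * ∫⁻ x, ‖u x‖ₑ ^ q ∂μ := by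
  have hp : Real.HolderConjugate (Module.finrank ℝ E) (Real.conjExponent (Module.finrank ℝ E)) :=
    .conjExponent (by exact_mod_cast hn)
  set p := Real.conjExponent (Module.finrank ℝ E)
  have hp0 : 0 < p := hp.symm.pos
  have hrq : 0 < r - q := sub_pos.2 hqr
  obtain ⟨k, hk⟩ := exists_nat_ge ((r - q) / p)
  rw [div_le_iff₀ hp0] at hk
  have hkp : 0 < k * p := hrq.trans_le hk
  obtain ⟨C, hC⟩ := exists_lintegral_rpow_add_nat_mul_conjExponent_le (F := F) μ hp hq k
  set θ := (r - q) / (k * p) with hθ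
  have hθ0 : 0 ≤ θ := by positivity
  have hθ1 : 0 ≤ 1 - θ := sub_nonneg.2 ((div_le_one hkp).2 hk)
  have hθkp : k * p * θ = r - q := mul_div_cancel₀ _ hkp.ne'
  refine ⟨C ^ θ, fun u hu h2u ↦ ?_⟩
  have hu_meas := hu.continuous.enorm.measurable
  calc ∫⁻ x, ‖u x‖ₑ ^ r ∂μ
      = ∫⁻ x, (‖u x‖ₑ ^ q) ^ (1 - θ) * (‖u x‖ₑ ^ (q + k * p)) ^ θ ∂μ := by
        refine lintegral_congr fun x ↦ ?_
        rw [← ENNReal.rpow_mul, ← ENNReal.rpow_mul,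
          ← ENNReal.rpow_add_of_nonneg _ _ (by positivity) (by positivity)]
        congr 1
        linear_combination -hθkp
    _ ≤ (∫⁻ x, ‖u x‖ₑ ^ q ∂μ) ^ (1 - θ) * (∫⁻ x, ‖u x‖ₑ ^ (q + k * p) ∂μ) ^ θ :=
        ENNReal.lintegral_mul_norm_pow_le (hu_meas.pow_const _).aemeasurable
          (hu_meas.pow_const _).aemeasurable hθ1 hθ0 (by ring)
    _ ≤ (∫⁻ x, ‖u x‖ₑ ^ q ∂μ) ^ (1 - θ) *
          (C * (∫⁻ x, ‖fderiv ℝ u x‖ₑ ^ (Module.finrank ℝ E : ℝ) ∂μ) ^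
              (k * p / Module.finrank ℝ E) * ∫⁻ x, ‖u x‖ₑ ^ q ∂μ) ^ θ := by
        gcongr
        exact hC u hu h2u
    _ = C ^ θ * (∫⁻ x, ‖fderiv ℝ u x‖ₑ ^ (Module.finrank ℝ E : ℝ) ∂μ) ^
          ((r - q) / Module.finrank ℝ E) *
          ((∫⁻ x, ‖u x‖ₑ ^ q ∂μ) ^ (1 - θ) * (∫⁻ x, ‖u x‖ₑ ^ q ∂μ) ^ θ) := by
        rw [ENNReal.mul_rpow_of_nonneg _ _ hθ0, ENNReal.mul_rpow_of_nonneg _ _ hθ0,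
          ← ENNReal.rpow_mul, div_mul_eq_mul_div, hθkp]
        ring
    _ = _ := by
        rw [← ENNReal.rpow_add_of_nonneg _ _ hθ1 hθ0, sub_add_cancel, ENNReal.rpow_one,
          ENNReal.coe_rpow_of_nonneg _ hθ0]

end GagliardoNirenberg

/-- **Gagliardo–Nirenberg interpolation inequality, conformal case `p = N`**
(Proposition 2.5, inequality (2.4)). For `1 ≤ q ≤ N` and `q < r < ∞`,
`(∫ |u|^r)^{1/r} ≤ C (∫ |∇u|^N)^{(r-q)/(Nr)} (∫ |u|^q)^{1/r}`. -/
theorem gagliardo_nirenberg_conformal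
    (N : ℕ) (hN : 2 ≤ N) (q : ℝ) (hq : 1 ≤ q) (hqN : q ≤ (N : ℝ)) :
    ∀ r : ℝ, q < r →
      ∃ C : ℝ, 0 < C ∧ ∀ u : EuclideanSpace ℝ (Fin N) → ℝ,
        ContDiff ℝ (⊤ : ℕ∞) u → HasCompactSupport u →
        (∫ x, |u x| ^ r) ^ (1 / r) ≤
          C * (∫ x, ‖gradient u x‖ ^ (N : ℝ)) ^ ((r - q) / ((N : ℝ) * r))
            * (∫ x, |u x| ^ q) ^ (1 / r) := by
  intro r hqr
  have hq0 : 0 < q := by linarith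
  have hr0 : 0 < r := hq0.trans hqr
  have hN0 : (0 : ℝ) < N := by positivity
  obtain ⟨C, hC⟩ := exists_lintegral_rpow_le_lintegral_fderiv_mul_lintegral_rpow
    (E := EuclideanSpace ℝ (Fin N)) (F := ℝ) volume (by simpa using hN) hq0 hqr
  refine ⟨(C + 1 : ℝ) ^ (1 / r), by positivity, fun u hu h2u ↦ ?_⟩
  have hu1 : ContDiff ℝ 1 u := hu.of_le (by exact_mod_cast le_top)
  have h_norm_grad (x) : ‖gradient u x‖ = ‖fderiv ℝ u x‖ := LinearIsometryEquiv.norm_map _ _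
  simp_rw [h_norm_grad, ← Real.norm_eq_abs]
  have h_main := hC u hu1 h2u
  rw [finrank_euclideanSpace_fin, hu1.continuous.lintegral_enorm_rpow_eq_ofReal_integral h2u hr0,
    hu1.continuous.lintegral_enorm_rpow_eq_ofReal_integral h2u hq0,
    (hu1.continuous_fderiv one_ne_zero).lintegral_enorm_rpow_eq_ofReal_integral
      (h2u.fderiv ℝ) hN0] at h_main
  have hA : 0 ≤ ∫ x, ‖u x‖ ^ r := integral_nonneg fun x ↦ by positivity
  have hG : 0 ≤ ∫ x, ‖fderiv ℝ u x‖ ^ (N : ℝ) := integral_nonneg fun x ↦ by positivity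
  have hB : 0 ≤ ∫ x, ‖u x‖ ^ q := integral_nonneg fun x ↦ by positivity
  rw [ENNReal.ofReal_rpow_of_nonneg hG (by have := sub_pos.2 hqr; positivity),
    ← ENNReal.ofReal_coe_nnreal, ← ENNReal.ofReal_mul (by positivity),
    ← ENNReal.ofReal_mul (by positivity), ENNReal.ofReal_le_ofReal_iff (by positivity)] at h_main
  calc (∫ x, ‖u x‖ ^ r) ^ (1 / r)
      ≤ ((C + 1) * (∫ x, ‖fderiv ℝ u x‖ ^ (N : ℝ)) ^ ((r - q) / N) * ∫ x, ‖u x‖ ^ q) ^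
          (1 / r) := by
        refine Real.rpow_le_rpow hA (h_main.trans ?_) (by positivity)
        gcongr
        linarith
    _ = _ := by
        rw [Real.mul_rpow (by positivity) hB, Real.mul_rpow (by positivity) (by positivity),
          ← Real.rpow_mul hG, div_mul_div_comm, mul_one]
end

section
/- Let N ≥ 2 and t > 1. For every smooth function u : ℝ^N → ℝ with compact support, ∫_{ℝ^N} |u|^{N t/(N−1)} dx ≤ t^{N/(N−1)} · ( ∫_{ℝ^N} |u|^{(t−1) N/(N−1)} dx ) · ( ∫_{ℝ^N} |∇u|^N dx )^{1/(N−1)}. -/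
open MeasureTheory Real Filter
open scoped ENNReal Topology NNReal

/-- The derivative of `y ↦ v (WithLp.toLp 2 y)` along a coordinate line is bounded by the norm of
the Fréchet derivative of `v` for the Euclidean norm. -/
theorem enorm_deriv_comp_toLp_update_le {N : ℕ} {v : EuclideanSpace ℝ (Fin N) → ℝ}
    (hv : Differentiable ℝ v) (x : Fin N → ℝ) (i : Fin N) (s : ℝ) :
    ‖deriv (fun r ↦ v (WithLp.toLp 2 (Function.update x i r))) s‖ₑ
      ≤ ‖fderiv ℝ v (WithLp.toLp 2 (Function.update x i s))‖ₑ := by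
  have hline : HasDerivAt (fun r ↦ WithLp.toLp 2 (Function.update x i r))
      (EuclideanSpace.single i (1 : ℝ)) s :=
    ((EuclideanSpace.equiv (Fin N) ℝ).symm.toContinuousLinearMap.hasFDerivAt).comp_hasDerivAt s
      (hasDerivAt_update x i s)
  have hcomp := (hv (WithLp.toLp 2 (Function.update x i s))).hasFDerivAt.comp_hasDerivAt s hline
  have hd := hcomp.deriv
  rw [Function.comp_def] at hd
  rw [hd]
  refine (ContinuousLinearMap.le_opENorm _ _).trans_eq ?_
  rw [show ‖EuclideanSpace.single i (1 : ℝ)‖ₑ = 1 by simp [← ofReal_norm], mul_one]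

/-- The **Gagliardo-Nirenberg-Sobolev inequality** for `q = 1` on Euclidean space, with constant
`1`. -/
theorem lintegral_pow_le_pow_lintegral_fderiv_euclidean {N : ℕ} {p : ℝ}
    (hp : Real.HolderConjugate N p) {v : EuclideanSpace ℝ (Fin N) → ℝ}
    (hv : ContDiff ℝ 1 v) (hvs : HasCompactSupport v) :
    ∫⁻ x, ‖v x‖ₑ ^ p ≤ (∫⁻ x, ‖fderiv ℝ v x‖ₑ) ^ p := by
  have hN : (0 : ℝ) < N - 1 := sub_pos.2 hp.lt
  have hmp := (EuclideanSpace.volume_preserving_symm_measurableEquiv_toLp (Fin N)).symm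
  have hf : Measurable fun x ↦ ‖fderiv ℝ v x‖ₑ :=
    (hv.continuous_fderiv one_ne_zero).enorm.measurable
  have hg : Measurable fun x ↦ ‖v x‖ₑ ^ p := hv.continuous.enorm.measurable.pow_const p
  rw [← hmp.lintegral_comp hf, ← hmp.lintegral_comp hg]
  change ∫⁻ x : Fin N → ℝ, ‖v (WithLp.toLp 2 x)‖ₑ ^ p
    ≤ (∫⁻ x : Fin N → ℝ, ‖fderiv ℝ v (WithLp.toLp 2 x)‖ₑ) ^ p
  have hp' : Real.HolderConjugate (Fintype.card (Fin N)) p := by simpa using hp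
  have hf' : Measurable fun x : Fin N → ℝ ↦ ‖fderiv ℝ v (WithLp.toLp 2 x)‖ₑ :=
    hf.comp (EuclideanSpace.equiv (Fin N) ℝ).symm.continuous.measurable
  refine le_trans ?_ (lintegral_prod_lintegral_pow_le (fun _ ↦ volume) hp' hf')
  refine lintegral_mono fun x ↦ ?_
  have hpow : ‖v (WithLp.toLp 2 x)‖ₑ ^ p
      = ∏ _i : Fin N, ‖v (WithLp.toLp 2 x)‖ₑ ^ ((1 : ℝ) / (Fintype.card (Fin N) - 1 : ℝ)) := by
    rw [Finset.prod_const, ← ENNReal.rpow_natCast, ← ENNReal.rpow_mul, hp.conjugate_eq]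
    congr 1
    simp
    field_simp
  rw [hpow]
  refine Finset.prod_le_prod' fun i _ ↦ ENNReal.rpow_le_rpow ?_ (by simpa using hN.le)
  have hsmooth : ContDiff ℝ 1 fun r ↦ v (WithLp.toLp 2 (Function.update x i r)) :=
    hv.comp ((EuclideanSpace.equiv (Fin N) ℝ).symm.contDiff.comp (contDiff_update 1 x i))
  have hsupp : HasCompactSupport fun r ↦ v (WithLp.toLp 2 (Function.update x i r)) :=
    hvs.comp_isClosedEmbedding
      ((EuclideanSpace.equiv (Fin N) ℝ).symm.toHomeomorph.isClosedEmbedding.comp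
        (isClosedEmbedding_update x i))
  calc ‖v (WithLp.toLp 2 x)‖ₑ
      ≤ ∫⁻ s in Set.Iic (x i),
          ‖deriv (fun r ↦ v (WithLp.toLp 2 (Function.update x i r))) s‖ₑ := by
        simpa using HasCompactSupport.enorm_le_lintegral_Ici_deriv hsmooth hsupp (x i)
    _ ≤ ∫⁻ s, ‖deriv (fun r ↦ v (WithLp.toLp 2 (Function.update x i r))) s‖ₑ :=
        setLIntegral_le_lintegral _ _
    _ ≤ ∫⁻ s, ‖fderiv ℝ v (WithLp.toLp 2 (Function.update x i s))‖ₑ :=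
        lintegral_mono fun s ↦
          enorm_deriv_comp_toLp_update_le (hv.differentiable one_ne_zero) x i s

/-- Bochner-integral form of `lintegral_pow_le_pow_lintegral_fderiv_euclidean`. -/
theorem integral_pow_le_pow_integral_fderiv_euclidean {N : ℕ} {p : ℝ}
    (hp : Real.HolderConjugate N p) {v : EuclideanSpace ℝ (Fin N) → ℝ}
    (hv : ContDiff ℝ 1 v) (hvs : HasCompactSupport v) :
    ∫ x, ‖v x‖ ^ p ≤ (∫ x, ‖fderiv ℝ v x‖) ^ p := by
  have hp0 : 0 < p := hp.symm.pos
  have hint : Integrable fun x ↦ ‖fderiv ℝ v x‖ :=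
    ((hv.continuous_fderiv one_ne_zero).integrable_of_hasCompactSupport (hvs.fderiv ℝ)).norm
  have hfin : ∫⁻ x, ‖fderiv ℝ v x‖ₑ = ENNReal.ofReal (∫ x, ‖fderiv ℝ v x‖) := by
    rw [ofReal_integral_eq_lintegral_ofReal hint (ae_of_all _ fun _ ↦ norm_nonneg _)]
    simp
  have hnn : 0 ≤ ∫ x, ‖fderiv ℝ v x‖ := integral_nonneg fun _ ↦ norm_nonneg _
  have key := lintegral_pow_le_pow_lintegral_fderiv_euclidean hp hv hvs
  rw [hfin, ENNReal.ofReal_rpow_of_nonneg hnn hp0.le] at key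
  rw [integral_eq_lintegral_of_nonneg_ae (ae_of_all _ fun _ ↦ by positivity)
    (hv.continuous.norm.rpow_const fun _ ↦ Or.inr hp0.le).aestronglyMeasurable]
  refine ENNReal.toReal_le_of_le_ofReal (by positivity) (le_trans (le_of_eq ?_) key)
  refine lintegral_congr fun x ↦ ?_
  rw [← ENNReal.ofReal_rpow_of_nonneg (norm_nonneg _) hp0.le, ofReal_norm]

theorem norm_fderiv_abs_rpow {E : Type*} [NormedAddCommGroup E] [NormedSpace ℝ E] {u : E → ℝ}
    {x : E} (hu : DifferentiableAt ℝ u x) {t : ℝ} (ht : 1 < t) :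
    ‖fderiv ℝ (fun y ↦ |u y| ^ t) x‖ = t * (|u x| ^ (t - 1) * ‖fderiv ℝ u x‖) := by
  have h := ((hasDerivAt_abs_rpow (u x) ht).comp_hasFDerivAt x hu.hasFDerivAt).fderiv
  rw [Function.comp_def] at h
  rw [h, norm_smul, ← mul_assoc]
  congr 1
  rw [Real.norm_eq_abs, abs_mul, abs_mul, abs_of_pos (by linarith : 0 < t),
    abs_of_nonneg (by positivity : 0 ≤ |u x| ^ (t - 2)), mul_assoc]
  congr 1
  rcases eq_or_ne (u x) 0 with h0 | h0
  · simp [h0, Real.zero_rpow (by linarith : t - 1 ≠ 0)]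
  · rw [← Real.rpow_add_one (abs_ne_zero.2 h0)]
    ring_nf

theorem norm_gradient {E : Type*} [NormedAddCommGroup E] [InnerProductSpace ℝ E] [CompleteSpace E]
    (u : E → ℝ) (x : E) : ‖gradient u x‖ = ‖fderiv ℝ u x‖ :=
  (InnerProductSpace.toDual ℝ E).symm.norm_map _

/-- **Anisotropic estimate in the proof of the conformal Gagliardo–Nirenberg
inequality**: for `N ≥ 2`, `t > 1` and every smooth compactly supported `u`,
`∫ |u|^{Nt/(N-1)} ≤ t^{N/(N-1)} (∫ |u|^{(t-1)N/(N-1)}) (∫ |∇u|^N)^{1/(N-1)}`. -/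
theorem conformal_key_estimate
    (N : ℕ) (hN : 2 ≤ N) (t : ℝ) (ht : 1 < t) :
    ∀ u : EuclideanSpace ℝ (Fin N) → ℝ,
      ContDiff ℝ (⊤ : ℕ∞) u → HasCompactSupport u →
      ∫ x, |u x| ^ ((N : ℝ) * t / ((N : ℝ) - 1)) ≤
        t ^ ((N : ℝ) / ((N : ℝ) - 1))
          * (∫ x, |u x| ^ ((t - 1) * (N : ℝ) / ((N : ℝ) - 1)))
          * (∫ x, ‖gradient u x‖ ^ (N : ℝ)) ^ (1 / ((N : ℝ) - 1)) := by
  intro u hu hus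
  have hN1 : (1 : ℝ) < N := by exact_mod_cast hN
  have hN0 : (0 : ℝ) < N - 1 := sub_pos.2 hN1
  have ht0 : 0 < t := by linarith
  have ht1 : 0 < t - 1 := by linarith
  set p : ℝ := (N : ℝ) / ((N : ℝ) - 1) with hpdef
  have hp : Real.HolderConjugate N p := Real.HolderConjugate.conjExponent hN1
  have hp0 : 0 < p := hp.symm.pos
  have hu1 : ContDiff ℝ 1 u := hu.of_le (by exact_mod_cast le_top)
  have hw : ContDiff ℝ 1 fun x ↦ |u x| ^ t := (contDiff_norm_rpow (E := ℝ) ht).comp hu1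
  have hws : HasCompactSupport fun x ↦ |u x| ^ t :=
    hus.comp_left (g := fun a : ℝ ↦ |a| ^ t) (by simp [Real.zero_rpow ht0.ne'])
  have hsob := integral_pow_le_pow_integral_fderiv_euclidean hp hw hws
  simp_rw [norm_fderiv_abs_rpow (hu1.differentiable one_ne_zero _) ht] at hsob
  rw [integral_const_mul] at hsob
  have hF : MemLp (fun x ↦ |u x| ^ (t - 1)) (ENNReal.ofReal p) volume :=
    (hu1.continuous.abs.rpow_const fun _ ↦ Or.inr ht1.le).memLp_of_hasCompactSupport
      (hus.comp_left (g := fun a : ℝ ↦ |a| ^ (t - 1)) (by simp [Real.zero_rpow ht1.ne']))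
  have hG : MemLp (fun x ↦ ‖fderiv ℝ u x‖) (ENNReal.ofReal N) volume :=
    ((hu1.continuous_fderiv one_ne_zero).memLp_of_hasCompactSupport (hus.fderiv ℝ)).norm
  have hholder := integral_mul_le_Lp_mul_Lq_of_nonneg hp.symm
    (ae_of_all _ fun x ↦ by positivity) (ae_of_all _ fun x ↦ norm_nonneg _) hF hG
  have hA : 0 ≤ ∫ x, (|u x| ^ (t - 1)) ^ p := integral_nonneg fun _ ↦ by positivity
  have hB : 0 ≤ ∫ x, ‖fderiv ℝ u x‖ ^ (N : ℝ) := integral_nonneg fun _ ↦ by positivity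
  have hAB : 0 ≤ ∫ x, |u x| ^ (t - 1) * ‖fderiv ℝ u x‖ := integral_nonneg fun _ ↦ by positivity
  calc ∫ x, |u x| ^ ((N : ℝ) * t / ((N : ℝ) - 1))
      = ∫ x, ‖|u x| ^ t‖ ^ p := by
        refine integral_congr_ae (ae_of_all _ fun x ↦ ?_)
        simp only [Real.norm_eq_abs]
        rw [abs_of_nonneg (by positivity : 0 ≤ |u x| ^ t), ← Real.rpow_mul (abs_nonneg _), hpdef]
        congr 1
        ring
    _ ≤ (t * ∫ x, |u x| ^ (t - 1) * ‖fderiv ℝ u x‖) ^ p := hsob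
    _ = t ^ p * (∫ x, |u x| ^ (t - 1) * ‖fderiv ℝ u x‖) ^ p := Real.mul_rpow ht0.le hAB
    _ ≤ t ^ p * ((∫ x, (|u x| ^ (t - 1)) ^ p) ^ (1 / p)
          * (∫ x, ‖fderiv ℝ u x‖ ^ (N : ℝ)) ^ (1 / (N : ℝ))) ^ p := by gcongr
    _ = t ^ p * (∫ x, |u x| ^ ((t - 1) * (N : ℝ) / ((N : ℝ) - 1)))
          * (∫ x, ‖gradient u x‖ ^ (N : ℝ)) ^ (1 / ((N : ℝ) - 1)) := by
        rw [Real.mul_rpow (by positivity) (by positivity), ← Real.rpow_mul hA, ← Real.rpow_mul hB,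
          one_div_mul_cancel hp0.ne', Real.rpow_one, ← mul_assoc]
        simp_rw [norm_gradient, ← Real.rpow_mul (abs_nonneg _)]
        rw [hpdef, ← mul_div_assoc,
          show 1 / (N : ℝ) * (N / (N - 1)) = 1 / (N - 1) by field_simp]
end

section
/- Let N ≥ 2 and 1 < p < N, and set p' = p/(p−1). There exists a constant C = C(N,p) > 0 with the following property: if w : ℝ^N → [0,∞) is a Lipschitz function with ∫_{ℝ^N} w dx < ∞ which satisfies, for every k ≥ 0, the energy identity ∫_{{w > k}} |∇w|^p dx = ∫_{ℝ^N} (w − k)_+ dx (where ∇w is the almost-everywhere defined gradient of w and (w−k)_+ = max{w−k, 0}), then w is essentially bounded and ‖w‖_{L^∞} ≤ C · ( ∫_{ℝ^N} w dx )^{p'/(N+p')}. -/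
open MeasureTheory Real Filter
open scoped ENNReal Topology NNReal

section Mollification

open scoped Convolution Pointwise
open Module ContinuousLinearMap

variable {E : Type*} [NormedAddCommGroup E] [NormedSpace ℝ E] [FiniteDimensional ℝ E]
  [MeasurableSpace E] [BorelSpace E] {μ : Measure E} [μ.IsAddHaarMeasure]

lemma LipschitzWith.locallyIntegrable_fderiv {v : E → ℝ} {K : ℝ≥0}
    (hv : LipschitzWith K v) : LocallyIntegrable (fderiv ℝ v) μ := by
  have hm : AEStronglyMeasurable (fderiv ℝ v) μ := (measurable_fderiv ℝ v).aestronglyMeasurable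
  exact (locallyIntegrable_const (K : ℝ)).mono hm (.of_forall fun x => by
    simpa using norm_fderiv_le_of_lipschitz ℝ hv)

/-- The derivative falls on the Lipschitz factor of a convolution with a continuous, compactly
supported kernel. -/
lemma LipschitzWith.hasFDerivAt_convolution {φ v : E → ℝ} {K : ℝ≥0}
    (hφ : Continuous φ) (hφs : HasCompactSupport φ) (hv : LipschitzWith K v) (x : E) :
    HasFDerivAt (φ ⋆[lsmul ℝ ℝ, μ] v) ((φ ⋆[lsmul ℝ ℝ, μ] fderiv ℝ v) x) x := by
  have hφi : Integrable φ μ := hφ.integrable_of_hasCompactSupport hφs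
  have hmp := quasiMeasurePreserving_sub_left μ x
  have hcont : ∀ y, Continuous fun t => φ t • v (y - t) := fun y =>
    hφ.smul (hv.continuous.comp (continuous_const.sub continuous_id))
  have key := hasFDerivAt_integral_of_dominated_loc_of_lip (𝕜 := ℝ) (μ := μ) (x₀ := x)
    (F := fun y t => φ t • v (y - t)) (F' := fun t => φ t • fderiv ℝ v (x - t))
    (bound := fun t => ‖φ t‖ * K) (s := Set.univ) univ_mem
    (.of_forall fun y => (hcont y).aestronglyMeasurable)
    ((hcont x).integrable_of_hasCompactSupport (hφs.smul_right))
    (hφ.aestronglyMeasurable.smul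
      ((measurable_fderiv ℝ v).comp hmp.measurable).aestronglyMeasurable)
    (.of_forall fun t => by
      refine LipschitzOnWith.of_dist_le_mul fun y _ z _ => ?_
      have h := hv.dist_le_mul (y - t) (z - t)
      rw [dist_sub_right] at h
      rw [dist_smul₀, Real.coe_nnabs, abs_of_nonneg (by positivity), mul_assoc]
      gcongr)
    (hφi.norm.mul_const _)
    (by
      filter_upwards [hmp.ae (hv.ae_differentiableAt (μ := μ))] with t ht
      have h : HasFDerivAt (fun y => v (y - t)) (fderiv ℝ v (x - t)) x := by
        simpa [Function.comp_def] using ht.hasFDerivAt.comp x ((hasFDerivAt_id x).sub_const t)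
      exact h.const_smul (φ t))
  exact key.2

lemma ContDiffBump.norm_convolution_le {F : Type*} [NormedAddCommGroup F] [NormedSpace ℝ F]
    (φ : ContDiffBump (0 : E)) {g : E → F} {K : ℝ} (hg : ∀ x, ‖g x‖ ≤ K) (x : E) :
    ‖(φ.normed μ ⋆[lsmul ℝ ℝ, μ] g) x‖ ≤ K := by
  calc ‖∫ t, φ.normed μ t • g (x - t) ∂μ‖ ≤ ∫ t, φ.normed μ t * K ∂μ := by
        refine norm_integral_le_of_norm_le (φ.integrable_normed.mul_const K) (.of_forall fun t => ?_)
        rw [norm_smul, Real.norm_of_nonneg (φ.nonneg_normed t)]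
        exact mul_le_mul_of_nonneg_left (hg _) (φ.nonneg_normed t)
    _ = K := by rw [integral_mul_const, φ.integral_normed, one_mul]

/-- The **Gagliardo-Nirenberg-Sobolev inequality** for compactly supported Lipschitz functions. -/
theorem LipschitzWith.eLpNorm_le_eLpNorm_fderiv_of_eq {v : E → ℝ} {K : ℝ≥0}
    (hv : LipschitzWith K v) (hvs : HasCompactSupport v)
    {p q : ℝ≥0} (hp : 1 ≤ p) (hn : 0 < finrank ℝ E)
    (hq : (q : ℝ)⁻¹ = (p : ℝ)⁻¹ - (finrank ℝ E : ℝ)⁻¹) :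
    eLpNorm v q μ ≤ SNormLESNormFDerivOfEqConst ℝ μ p * eLpNorm (fderiv ℝ v) p μ := by
  have hp0 : 0 < p := one_pos.trans_le hp
  have hpp : (p : ℝ≥0∞) ≠ 0 := by exact_mod_cast hp0.ne'
  let φ : ℕ → ContDiffBump (0 : E) := fun n =>
    ⟨1 / ((n : ℝ) + 1) / 2, 1 / ((n : ℝ) + 1), by positivity, half_lt_self (by positivity)⟩
  have hφ : Tendsto (fun n => (φ n).rOut) atTop (𝓝 0) := tendsto_one_div_add_atTop_nhds_zero_nat
  let u : ℕ → E → ℝ := fun n => (φ n).normed μ ⋆[lsmul ℝ ℝ, μ] v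
  have hu : ∀ n, ContDiff ℝ 1 (u n) := fun n =>
    (φ n).hasCompactSupport_normed.contDiff_convolution_left (n := 1) _ (φ n).contDiff_normed
      hv.continuous.locallyIntegrable
  have hus : ∀ n, HasCompactSupport (u n) := fun n =>
    (φ n).hasCompactSupport_normed.convolution _ hvs
  have hdu : ∀ n, fderiv ℝ (u n) = (φ n).normed μ ⋆[lsmul ℝ ℝ, μ] fderiv ℝ v := fun n => by
    ext1 x
    exact (hv.hasFDerivAt_convolution (φ n).continuous_normed (φ n).hasCompactSupport_normed x).fderiv
  have hdK : ∀ n x, ‖fderiv ℝ (u n) x‖ ≤ K := fun n x => by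
    rw [hdu]
    exact (φ n).norm_convolution_le (fun y => norm_fderiv_le_of_lipschitz ℝ hv) x
  let S : Set E := Metric.closedBall (0 : E) 1 + tsupport v
  have hS : IsCompact S := (isCompact_closedBall 0 1).add hvs
  have hsupp : ∀ n x, x ∉ S → fderiv ℝ (u n) x = 0 := fun n x hx => by
    have h : Function.support (fderiv ℝ (u n)) ⊆ S := by
      refine (support_fderiv_subset ℝ).trans (closure_minimal ?_ hS.isClosed)
      refine (support_convolution_subset _).trans (Set.add_subset_add ?_ (subset_tsupport v))
      rw [ContDiffBump.support_normed_eq]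
      refine Metric.ball_subset_closedBall.trans (Metric.closedBall_subset_closedBall ?_)
      change 1 / ((n : ℝ) + 1) ≤ 1
      rw [div_le_one (by positivity)]
      linarith [n.cast_nonneg (α := ℝ)]
    by_contra h0
    exact hx (h h0)
  have hlim : Tendsto (fun n => eLpNorm (fderiv ℝ (u n)) p μ) atTop
      (𝓝 (eLpNorm (fderiv ℝ v) p μ)) := by
    simp only [eLpNorm_eq_lintegral_rpow_enorm_toReal hpp ENNReal.coe_ne_top]
    refine (ENNReal.continuous_rpow_const.tendsto _).comp ?_
    refine tendsto_lintegral_of_dominated_convergence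
      (S.indicator fun _ => (K : ℝ≥0∞) ^ (p : ℝ≥0∞).toReal)
      (fun n => (measurable_fderiv ℝ (u n)).enorm.pow_const _) (fun n => .of_forall fun x => ?_)
      ?_ ?_
    · by_cases hx : x ∈ S
      · simp only [Set.indicator_of_mem hx]
        gcongr
        exact_mod_cast hdK n x
      · simp [hsupp n x hx, hx, hp0, enorm_eq_nnnorm]
    · rw [lintegral_indicator hS.measurableSet, lintegral_const, Measure.restrict_apply_univ]
      exact ENNReal.mul_ne_top (by simp) hS.measure_lt_top.ne
    · filter_upwards [ContDiffBump.ae_convolution_tendsto_right_of_locallyIntegrable (K := 2) hφ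
        (.of_forall fun n => le_of_eq (by simp only [φ]; ring))
        (hv.locallyIntegrable_fderiv (μ := μ))] with x hx
      simp only [hdu]
      exact (ENNReal.continuous_rpow_const.tendsto _).comp hx.enorm
  calc eLpNorm v q μ ≤ liminf (fun n => eLpNorm (u n) q μ) atTop :=
        Lp.eLpNorm_lim_le_liminf_eLpNorm (fun n => (hu n).continuous.aestronglyMeasurable) v
          (.of_forall fun x =>
            ContDiffBump.convolution_tendsto_right_of_continuous hφ hv.continuous x)
    _ ≤ liminf (fun n => SNormLESNormFDerivOfEqConst ℝ μ p * eLpNorm (fderiv ℝ (u n)) p μ) atTop :=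
        liminf_le_liminf (.of_forall fun n =>
          MeasureTheory.eLpNorm_le_eLpNorm_fderiv_of_eq μ (hu n) (hus n) hp hn hq)
    _ = _ := (ENNReal.Tendsto.const_mul hlim (.inr ENNReal.coe_ne_top)).liminf_eq

/-- A nonnegative integrable Lipschitz function has bounded positive superlevel sets. -/
lemma LipschitzWith.isBounded_superlevel {w : E → ℝ} {K : ℝ≥0}
    (hw : LipschitzWith K w) (hw0 : ∀ x, 0 ≤ w x) (hwi : Integrable w μ) {k : ℝ} (hk : 0 < k) :
    Bornology.IsBounded {x | k < w x} := by
  set r : ℝ := k / (2 * (K + 1)) with hr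
  have hr0 : 0 < r := by positivity
  have hball : 0 < μ.real (Metric.ball (0 : E) r) :=
    ENNReal.toReal_pos (Metric.measure_ball_pos μ 0 hr0).ne' measure_ball_lt_top.ne
  obtain ⟨g, hgs, hg, -, hgi⟩ := hwi.exists_hasCompactSupport_integral_sub_le
    (ε := k / 4 * μ.real (Metric.ball (0 : E) r)) (by positivity)
  refine (hgs.isBounded.cthickening (δ := r)).subset fun x hx => ?_
  by_contra hxt
  have hfar : ∀ y ∈ Metric.ball x r, g y = 0 := fun y hy => by
    by_contra h0
    refine hxt (Metric.mem_cthickening_of_dist_le x y r _ (subset_tsupport g h0) ?_)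
    rw [dist_comm]; exact (Metric.mem_ball.1 hy).le
  have hlow : ∀ y ∈ Metric.ball x r, k / 2 ≤ ‖w y - g y‖ := fun y hy => by
    rw [hfar y hy, sub_zero, Real.norm_of_nonneg (hw0 y)]
    have h1 := hw.dist_le_mul x y
    have h2 : dist x y ≤ r := by rw [dist_comm]; exact (Metric.mem_ball.1 hy).le
    have h3 : (K : ℝ) * dist x y ≤ k / 2 := by
      calc (K : ℝ) * dist x y ≤ (K + 1) * r := by gcongr; linarith
        _ = k / 2 := by rw [hr]; field_simp
    rw [Real.dist_eq] at h1
    have := (abs_le.1 h1).2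
    have hx' : k < w x := hx
    linarith
  have hint : Integrable (fun y => ‖w y - g y‖) μ := (hwi.sub hgi).norm
  have h1 : k / 2 * μ.real (Metric.ball x r) ≤ ∫ y in Metric.ball x r, ‖w y - g y‖ ∂μ :=
    setIntegral_ge_of_const_le_real measurableSet_ball measure_ball_lt_top.ne hlow hint.integrableOn
  have h2 : ∫ y in Metric.ball x r, ‖w y - g y‖ ∂μ ≤ ∫ y, ‖w y - g y‖ ∂μ :=
    setIntegral_le_integral hint (.of_forall fun y => norm_nonneg _)
  have h3 : μ.real (Metric.ball x r) = μ.real (Metric.ball (0 : E) r) := by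
    simp only [measureReal_def, Measure.addHaar_ball_center]
  rw [h3] at h1
  nlinarith

end Mollification

section LevelSets

/-- A De Giorgi-Stampacchia iteration. -/
lemma exists_forall_level_eq_zero {C δ : ℝ} (hC : 0 < C) (hδ : 0 < δ) :
    ∃ C' : ℝ, 0 < C' ∧ ∀ g A : ℝ → ℝ, (∀ k, 0 ≤ g k) → AntitoneOn g (Set.Ici 0) → (∀ k, 0 ≤ A k) →
      (∀ k h, 0 ≤ k → k < h → (h - k) * A h ≤ g k) →
      (∀ h, 0 < h → g h ≤ C * A h ^ (1 + δ)) →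
      g (C' * g 0 ^ (δ / (1 + δ))) = 0 := by
  have ht : 0 < 1 + δ := by linarith
  set r : ℝ := 2 ^ (-((1 + δ) / δ)) with hr
  have hr0 : 0 < r := by positivity
  have hr1 : r < 1 := rpow_lt_one_of_one_lt_of_neg one_lt_two (by simp only [neg_lt_zero]; positivity)
  have hrt : r ^ δ * 2 ^ (1 + δ) = 1 := by
    rw [hr, ← rpow_mul two_pos.le, ← rpow_add two_pos]
    have : -((1 + δ) / δ) * δ + (1 + δ) = 0 := by field_simp; ring
    rw [this, rpow_zero]
  refine ⟨C ^ (1 / (1 + δ)) / r, by positivity, fun g A hg hanti hA hcheb hsob => ?_⟩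
  set M : ℝ := C ^ (1 / (1 + δ)) / r * g 0 ^ (δ / (1 + δ)) with hM
  rcases (hg 0).eq_or_lt with h0 | h0
  · have : M = 0 := by rw [hM, ← h0, zero_rpow (by positivity), mul_zero]
    rw [this, ← h0]
  have hM0 : 0 < M := by positivity
  have hMt : M ^ (1 + δ) * r ^ (1 + δ) = C * g 0 ^ δ := by
    rw [← mul_rpow hM0.le hr0.le]
    have : M * r = C ^ (1 / (1 + δ)) * g 0 ^ (δ / (1 + δ)) := by rw [hM]; field_simp
    rw [this, mul_rpow (by positivity) (by positivity), ← rpow_mul hC.le, ← rpow_mul h0.le,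
      one_div_mul_cancel ht.ne', rpow_one, div_mul_cancel₀ _ ht.ne']
  have step : ∀ j : ℕ, g (M * (1 - (1 / 2) ^ j)) ≤ g 0 * r ^ j := by
    intro j
    induction j with
    | zero => simp
    | succ j ih =>
      have hj1 : ((1 : ℝ) / 2) ^ j ≤ 1 := pow_le_one₀ (by norm_num) (by norm_num)
      have hj0 : (0 : ℝ) < (1 / 2) ^ j := by positivity
      have hdiff : M * (1 - (1 / 2) ^ (j + 1)) - M * (1 - (1 / 2) ^ j) = M / 2 ^ (j + 1) := by
        simp only [one_div, inv_pow, pow_succ]; field_simp; ring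
      have hd0 : 0 < M / 2 ^ (j + 1) := by positivity
      have hk0 : 0 ≤ M * (1 - (1 / 2) ^ j) := mul_nonneg hM0.le (by linarith)
      have h1 := hcheb _ (M * (1 - (1 / 2) ^ (j + 1))) hk0 (by linarith)
      rw [hdiff] at h1
      set a := A (M * (1 - (1 / 2) ^ (j + 1))) with ha
      have h2 : a ≤ g 0 * (r ^ j * 2 ^ (j + 1)) / M := by
        rw [le_div_iff₀ hM0]
        calc a * M = M / 2 ^ (j + 1) * a * 2 ^ (j + 1) := by field_simp
          _ ≤ g 0 * r ^ j * 2 ^ (j + 1) := by exact mul_le_mul_of_nonneg_right (h1.trans ih) (by positivity)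
          _ = _ := by ring
      have h3 : (r ^ j * 2 ^ (j + 1)) ^ (1 + δ) * r ^ (1 + δ) = r ^ (j + 1) := by
        rw [mul_rpow (by positivity) (by positivity), ← rpow_pow_comm hr0.le,
          ← rpow_pow_comm two_pos.le, rpow_add hr0, rpow_one]
        calc (r * r ^ δ) ^ j * (2 ^ (1 + δ)) ^ (j + 1) * (r * r ^ δ)
            = r ^ (j + 1) * (r ^ δ * 2 ^ (1 + δ)) ^ (j + 1) := by ring
          _ = _ := by rw [hrt, one_pow, mul_one]
      calc g (M * (1 - (1 / 2) ^ (j + 1))) ≤ C * a ^ (1 + δ) := hsob _ (by linarith)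
        _ ≤ C * (g 0 * (r ^ j * 2 ^ (j + 1)) / M) ^ (1 + δ) := by
          gcongr; exact hA _
        _ = g 0 * r ^ (j + 1) := by
          rw [div_rpow (by positivity) hM0.le, mul_rpow h0.le (by positivity), ← h3]
          have hMp : M ^ (1 + δ) ≠ 0 := by positivity
          field_simp
          rw [mul_right_comm, hMt, rpow_add h0, rpow_one]
          ring
  refine le_antisymm (ge_of_tendsto (x := atTop) (f := fun j : ℕ => g 0 * r ^ j) ?_
    (.of_forall fun j => ?_)) (hg _)
  · simpa using (tendsto_pow_atTop_nhds_zero_of_lt_one hr0.le hr1).const_mul (g 0)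
  · have hj0 : (0 : ℝ) < (1 / 2) ^ j := by positivity
    have hj1 : ((1 : ℝ) / 2) ^ j ≤ 1 := pow_le_one₀ (by norm_num) (by norm_num)
    refine (hanti ?_ hM0.le ?_).trans (step j)
    · exact mul_nonneg hM0.le (by linarith)
    · nlinarith

open Module

/-- If the Dirichlet energy of a nonnegative function is at most its integral, the Sobolev and
Hölder inequalities bound the integral by a power of the measure of the support. -/
lemma exists_integral_le_measure_support_rpow {E : Type*} [NormedAddCommGroup E] [NormedSpace ℝ E]
    [FiniteDimensional ℝ E] [MeasurableSpace E] [BorelSpace E] (μ : Measure E) [μ.IsAddHaarMeasure]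
    {p : ℝ} (hp : 1 < p) (hpn : p < finrank ℝ E) :
    ∃ C : ℝ, 0 < C ∧ ∀ v : E → ℝ, (∃ K : ℝ≥0, LipschitzWith K v) → HasCompactSupport v →
      (∀ x, 0 ≤ v x) → ∫ x, ‖fderiv ℝ v x‖ ^ p ∂μ ≤ ∫ x, v x ∂μ →
      ∫ x, v x ∂μ ≤ C * μ.real (Function.support v) ^ (1 + p / (p - 1) / finrank ℝ E) := by
  have hp0 : 0 < p := by linarith
  set n : ℝ := (finrank ℝ E : ℝ) with hn
  have hn0 : 0 < n := by linarith
  have hpinv : n⁻¹ < p⁻¹ := inv_strictAnti₀ hp0 hpn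
  lift p to ℝ≥0 using hp0.le
  have hp' : 1 ≤ p := by exact_mod_cast hp.le
  obtain ⟨q, hq⟩ : ∃ q : ℝ≥0, (q : ℝ)⁻¹ = (p : ℝ)⁻¹ - n⁻¹ :=
    ⟨⟨((p : ℝ)⁻¹ - n⁻¹)⁻¹, by rw [inv_nonneg]; linarith⟩, inv_inv _⟩
  have hqi : 0 < (q : ℝ)⁻¹ := by linarith
  have hq0 : 0 < (q : ℝ) := inv_pos.1 hqi
  have hq1 : 1 ≤ (q : ℝ) := by
    rw [← inv_le_one₀ hq0, hq]
    have : (p : ℝ)⁻¹ ≤ 1 := inv_le_one_of_one_le₀ hp.le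
    have : 0 < n⁻¹ := by positivity
    linarith
  set S : ℝ≥0 := SNormLESNormFDerivOfEqConst ℝ μ p
  refine ⟨((S : ℝ) + 1) ^ ((p : ℝ) / (p - 1)), by positivity, fun v ⟨K, hv⟩ hvs hv0 hE => ?_⟩
  set G := ∫ x, v x ∂μ with hG
  have hG0 : 0 ≤ G := integral_nonneg hv0
  have hvi : Integrable v μ := hv.continuous.integrable_of_hasCompactSupport hvs
  have hsupp : μ (Function.support v) ≠ ∞ :=
    ((measure_mono (subset_tsupport v)).trans_lt hvs.measure_lt_top).ne
  set A := μ.real (Function.support v) with hA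
  have hA0 : 0 ≤ A := measureReal_nonneg
  have hdi : Integrable (fun x => ‖fderiv ℝ v x‖ ^ (p : ℝ)) μ := by
    rw [← integrableOn_iff_integrable_of_support_subset (s := tsupport v)]
    · refine Measure.integrableOn_of_bounded (M := (K : ℝ) ^ (p : ℝ)) hvs.measure_lt_top.ne
        ((measurable_fderiv ℝ v).norm.pow_const _).aestronglyMeasurable (.of_forall fun x => ?_)
      rw [Real.norm_of_nonneg (by positivity)]
      gcongr
      exact norm_fderiv_le_of_lipschitz ℝ hv
    · intro x hx
      refine support_fderiv_subset ℝ (f := v) fun h => hx ?_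
      simp [h, hp0.ne']
  have h1 : eLpNorm v 1 μ = ENNReal.ofReal G := by
    rw [hG, ofReal_integral_eq_lintegral_ofReal hvi (.of_forall hv0), eLpNorm_one_eq_lintegral_enorm]
    exact lintegral_congr fun x => Real.enorm_of_nonneg (hv0 x)
  have h2 : eLpNorm (fderiv ℝ v) p μ ≤ ENNReal.ofReal (G ^ (1 / (p : ℝ))) := by
    rw [eLpNorm_eq_lintegral_rpow_enorm_toReal (by exact_mod_cast hp0.ne') ENNReal.coe_ne_top,
      ENNReal.coe_toReal, ← ENNReal.ofReal_rpow_of_nonneg hG0 (by positivity)]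
    gcongr
    refine le_trans (le_of_eq ?_) (ENNReal.ofReal_le_ofReal hE)
    rw [ofReal_integral_eq_lintegral_ofReal hdi (.of_forall fun x => by positivity)]
    refine lintegral_congr fun x => ?_
    rw [← ENNReal.ofReal_rpow_of_nonneg (norm_nonneg _) hp0.le, ofReal_norm]
  have h3 : eLpNorm v 1 μ ≤ eLpNorm v q μ * μ (Function.support v) ^ (1 - 1 / (q : ℝ)) := by
    have := eLpNorm_le_eLpNorm_mul_rpow_measure_univ (p := 1) (q := q)
      (μ := μ.restrict (Function.support v)) (f := v) (by exact_mod_cast hq1)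
      hv.continuous.aestronglyMeasurable
    simpa [eLpNorm_restrict_eq_of_support_subset subset_rfl] using this
  have h4 : eLpNorm v q μ ≤ S * eLpNorm (fderiv ℝ v) p μ :=
    hv.eLpNorm_le_eLpNorm_fderiv_of_eq hvs hp' (Nat.cast_pos.1 (hn ▸ hn0)) hq
  have hexp : 0 ≤ 1 - 1 / (q : ℝ) := by
    rw [sub_nonneg, div_le_one hq0]; exact hq1
  have h5 : G ≤ S * G ^ (1 / (p : ℝ)) * A ^ (1 - 1 / (q : ℝ)) := by
    rw [← ENNReal.ofReal_le_ofReal_iff (by positivity), ← h1]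
    calc eLpNorm v 1 μ ≤ S * ENNReal.ofReal (G ^ (1 / (p : ℝ))) *
          μ (Function.support v) ^ (1 - 1 / (q : ℝ)) := by
          refine h3.trans ?_
          gcongr
          exact h4.trans (by gcongr)
      _ = _ := by
          rw [ENNReal.ofReal_mul (by positivity), ENNReal.ofReal_mul (by positivity),
            ENNReal.ofReal_coe_nnreal, ← ENNReal.ofReal_rpow_of_nonneg hA0 hexp, hA,
            measureReal_def, ENNReal.ofReal_toReal hsupp]
  rcases hG0.eq_or_lt with hz | hpos
  · rw [← hz]; positivity
  have hp1 : 0 < (p : ℝ) - 1 := by linarith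
  have h6 : G ^ (((p : ℝ) - 1) / p) ≤ (S + 1) * A ^ (1 - 1 / (q : ℝ)) := by
    have hGp : 0 < G ^ (1 / (p : ℝ)) := by positivity
    have hsplit : G ^ (((p : ℝ) - 1) / p) * G ^ (1 / (p : ℝ)) = G := by
      rw [← rpow_add hpos]
      have : ((p : ℝ) - 1) / p + 1 / p = 1 := by field_simp; ring
      rw [this, rpow_one]
    refine le_of_mul_le_mul_right ?_ hGp
    rw [hsplit]
    calc G ≤ S * G ^ (1 / (p : ℝ)) * A ^ (1 - 1 / (q : ℝ)) := h5
      _ ≤ (S + 1) * G ^ (1 / (p : ℝ)) * A ^ (1 - 1 / (q : ℝ)) := by gcongr; linarith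
      _ = _ := by ring
  calc G = (G ^ (((p : ℝ) - 1) / p)) ^ ((p : ℝ) / (p - 1)) := by
        rw [← rpow_mul hG0]
        have : ((p : ℝ) - 1) / p * (p / (p - 1)) = 1 := by field_simp
        rw [this, rpow_one]
    _ ≤ ((S + 1) * A ^ (1 - 1 / (q : ℝ))) ^ ((p : ℝ) / (p - 1)) := by gcongr
    _ = _ := by
        rw [mul_rpow (by positivity) (by positivity), ← rpow_mul hA0]
        congr 2
        rw [one_div, hq]
        field_simp
        ring

end LevelSets

/-- **`L^∞`–`L^1` a priori estimate** (Proposition 3.1, inequality (3.1)).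
For `1 < p < N` there is `C = C(N,p) > 0` such that any nonnegative integrable
Lipschitz function `w` on `ℝ^N` satisfying the energy identity
`∫_{{w>k}} |∇w|^p = ∫ (w-k)_+` for all `k ≥ 0` is essentially bounded with
`‖w‖_{L^∞} ≤ C (∫ w)^{p'/(N+p')}`, where `p' = p/(p-1)`. -/
theorem torsion_Linfty_L1_estimate
    (N : ℕ) (hN : 2 ≤ N) (p : ℝ) (hp : 1 < p) (hpN : p < (N : ℝ)) :
    ∃ C : ℝ, 0 < C ∧
      ∀ w : EuclideanSpace ℝ (Fin N) → ℝ,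
        (∃ K : ℝ≥0, LipschitzWith K w) →
        (∀ x, 0 ≤ w x) →
        Integrable w →
        (∀ k : ℝ, 0 ≤ k →
          ∫ x in {x | k < w x}, ‖gradient w x‖ ^ p = ∫ x, max (w x - k) 0) →
        ∀ᵐ x, w x ≤
          C * (∫ x, w x) ^ ((p / (p - 1)) / ((N : ℝ) + p / (p - 1))) := by
  have hp0 : 0 < p := by linarith
  have hp1 : 0 < p - 1 := by linarith
  have hN0 : (0 : ℝ) < N := by linarith
  obtain ⟨C, hC, hsob⟩ := exists_integral_le_measure_support_rpow
    (volume : Measure (EuclideanSpace ℝ (Fin N))) hp (by simpa using hpN)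
  obtain ⟨C', hC', hlevel⟩ :=
    exists_forall_level_eq_zero (δ := p / (p - 1) / N) hC (by positivity)
  refine ⟨C', hC', fun w ⟨K, hw⟩ hw0 hwi henergy => ?_⟩
  have hlip : ∀ k, LipschitzWith K fun x => max (w x - k) 0 := fun k =>
    (LipschitzWith.of_dist_le_mul fun x y => by
      simpa using hw.dist_le_mul x y : LipschitzWith K fun x => w x - k).max_const 0
  have hsupp : ∀ k, Function.support (fun x => max (w x - k) 0) = {x | k < w x} := fun k => by
    ext x
    simp [Function.mem_support]
  have hint : ∀ k, 0 ≤ k → Integrable fun x => max (w x - k) 0 := fun k hk =>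
    hwi.mono (hlip k).continuous.aestronglyMeasurable (.of_forall fun x => by
      rw [Real.norm_of_nonneg (le_max_right _ _), Real.norm_of_nonneg (hw0 x)]
      exact max_le (by linarith) (hw0 x))
  have hgrad : ∀ k x, ‖fderiv ℝ (fun x => max (w x - k) 0) x‖ ^ p =
      {x | k < w x}.indicator (fun x => ‖gradient w x‖ ^ p) x := fun k x => by
    by_cases hx : k < w x
    · have hev : (fun x => max (w x - k) 0) =ᶠ[𝓝 x] fun x => w x - k := by
        filter_upwards [hw.continuous.continuousAt.eventually_const_lt hx] with y hy
        exact max_eq_left (by linarith)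
      rw [Set.indicator_of_mem (by exact hx), hev.fderiv_eq, fderiv_sub_const, gradient,
        LinearIsometryEquiv.norm_map]
    · have hmin : IsLocalMin (fun x => max (w x - k) 0) x := .of_forall fun y => by
        change max (w x - k) 0 ≤ max (w y - k) 0
        rw [max_eq_right (by linarith : w x - k ≤ 0)]
        exact le_max_right _ _
      rw [Set.indicator_of_notMem (by exact hx), hmin.fderiv_eq_zero, norm_zero,
        zero_rpow hp0.ne']
  have hzero := hlevel (fun k => ∫ x, max (w x - k) 0) (fun k => volume.real {x | k < w x})
    (fun k => integral_nonneg fun x => le_max_right _ _)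
    (fun k hk h hh hkh => integral_mono (hint h hh) (hint k hk) fun x =>
      max_le_max_right 0 (by linarith))
    (fun k => measureReal_nonneg)
    (fun k h hk hkh => by
      have hfin : volume {x | h < w x} ≠ ∞ := by
        have := (hwi.measure_norm_gt_lt_top (hk.trans_lt hkh)).ne
        simpa only [Real.norm_of_nonneg (hw0 _)] using this
      refine (setIntegral_ge_of_const_le_real
        (measurableSet_lt measurable_const hw.continuous.measurable) hfin (fun x hx => ?_)
        (hint k hk).integrableOn).trans
        (setIntegral_le_integral (hint k hk) (.of_forall fun x => le_max_right _ _))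
      exact le_max_of_le_left (sub_le_sub_right (le_of_lt hx) k))
    (fun h hh => by
      have hcs : HasCompactSupport fun x => max (w x - h) 0 := by
        refine Metric.isCompact_of_isClosed_isBounded isClosed_closure ?_
        rw [tsupport, hsupp]
        exact (hw.isBounded_superlevel hw0 hwi hh).closure
      have := hsob _ ⟨K, hlip h⟩ hcs (fun x => le_max_right _ _) (by
        simp only [hgrad]
        rw [integral_indicator (measurableSet_lt measurable_const hw.continuous.measurable)]
        exact (henergy h hh.le).le)
      simpa only [hsupp, finrank_euclideanSpace_fin] using this)
  have hg0 : ∫ x, max (w x - 0) 0 = ∫ x, w x :=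
    integral_congr_ae (.of_forall fun x => by simp [hw0 x])
  have hexp : p / (p - 1) / N / (1 + p / (p - 1) / N) = p / (p - 1) / (N + p / (p - 1)) := by
    field_simp
  simp only [hg0, hexp] at hzero
  have hae := (integral_eq_zero_iff_of_nonneg (fun x => le_max_right _ _)
    (hint _ (mul_nonneg hC'.le (rpow_nonneg (integral_nonneg hw0) _)))).1 hzero
  filter_upwards [hae] with x hx
  exact sub_nonpos.1 ((le_max_left _ _).trans_eq hx)
end

section
/- Let N ≥ 1, 1 < p < ∞, and let Ω ⊆ ℝ^N be an open set. Let w : Ω → [0,∞) be a function of class C^1(Ω) with w ∈ L^1(Ω) ∩ L^∞(Ω) and with ‖w‖_{L^∞(Ω)} > 0, satisfying the torsion energy identity. Then for every β with 0 ≤ β ≤ (p−1)/p one has ∫_Ω |∇w(x)|^p · w(x)^{βp−p} dx = +∞ (the integrand being interpreted as 0 at points where ∇w(x) = 0). In particular, w^β does not belong to W^{1,p}(Ω) for 0 < β ≤ (p−1)/p, and log w does not belong to W^{1,p}(Ω) (the case β = 0). -/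
open MeasureTheory Real Filter
open scoped ENNReal Topology NNReal

/-- The derivative of `t ↦ arsinh (k t)`. -/
lemma hasDerivAt_arsinh_const_mul (k t : ℝ) :
    HasDerivAt (fun s => arsinh (k * s)) ((√(1 + (k * t) ^ 2))⁻¹ * k) t := by
  simpa [smul_eq_mul] using ((hasDerivAt_id t).const_mul k).arsinh

lemma abs_deriv_arsinh_const_mul_le (k t : ℝ) :
    |deriv (fun s => arsinh (k * s)) t| ≤ |k| := by
  rw [(hasDerivAt_arsinh_const_mul k t).deriv, abs_mul, abs_of_nonneg (by positivity)]
  have h : 1 ≤ √(1 + (k * t) ^ 2) := Real.one_le_sqrt.2 (by nlinarith [sq_nonneg (k * t)])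
  exact mul_le_of_le_one_left (abs_nonneg k) (inv_le_one_of_one_le₀ h)

lemma deriv_arsinh_const_mul_nonneg {k : ℝ} (hk : 0 ≤ k) (t : ℝ) :
    0 ≤ deriv (fun s => arsinh (k * s)) t := by
  rw [(hasDerivAt_arsinh_const_mul k t).deriv]
  positivity

lemma deriv_arsinh_const_mul_le_inv (k : ℝ) {t : ℝ} (ht : 0 < t) :
    deriv (fun s => arsinh (k * s)) t ≤ t⁻¹ := by
  rw [(hasDerivAt_arsinh_const_mul k t).deriv]
  have h : k * t ≤ √(1 + (k * t) ^ 2) := Real.le_sqrt_of_sq_le (by linarith)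
  have hpos : 0 < √(1 + (k * t) ^ 2) := by positivity
  rw [inv_mul_eq_div, inv_eq_one_div, div_le_div_iff₀ hpos ht]
  linarith

/-- On `(0, M]` the function `t⁻¹` is controlled by any power `t ^ r` with `r ≤ -1`. -/
lemma inv_le_rpow_mul_rpow {t M r : ℝ} (ht : 0 < t) (htM : t ≤ M) (hr : r ≤ -1) :
    t⁻¹ ≤ M ^ (-1 - r) * t ^ r := by
  have h : t ^ (-1 - r) ≤ M ^ (-1 - r) := Real.rpow_le_rpow ht.le htM (by linarith)
  calc t⁻¹ = t ^ (-1 - r) * t ^ r := by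
        rw [← Real.rpow_add ht, sub_add_cancel, Real.rpow_neg_one]
    _ ≤ _ := by gcongr

/-- A nonnegative function on an open set has vanishing gradient at its zeros. -/
lemma gradient_eq_zero_of_nonneg_of_eq_zero {E : Type*} [NormedAddCommGroup E]
    [InnerProductSpace ℝ E] [CompleteSpace E] {Ω : Set E} (hΩ : IsOpen Ω) {w : E → ℝ}
    (hw : ∀ x ∈ Ω, 0 ≤ w x) {x : E} (hx : x ∈ Ω) (h0 : w x = 0) : gradient w x = 0 := by
  have hmin : IsLocalMin w x := by
    filter_upwards [hΩ.mem_nhds hx] with y hy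
    rw [h0]
    exact hw y hy
  simp [gradient, hmin.fderiv_eq_zero]

/-- A function with positive essential supremum exceeds some positive level on a non-null set. -/
lemma exists_pos_measure_ge_ne_zero {α : Type*} [MeasurableSpace α] {μ : Measure α} {f : α → ℝ}
    (hf : 0 < essSup (fun x => ENNReal.ofReal (f x)) μ) :
    ∃ δ : ℝ, 0 < δ ∧ μ {x | δ ≤ f x} ≠ 0 := by
  obtain ⟨c, hc0, hc⟩ := exists_between hf
  have hctop : c ≠ ⊤ := hc.ne_top
  refine ⟨c.toReal, ENNReal.toReal_pos hc0.ne' hctop, fun h => hc.not_ge ?_⟩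
  refine essSup_le_of_ae_le c ?_
  filter_upwards [measure_eq_zero_iff_ae_notMem.1 h] with x hx
  exact ENNReal.ofReal_le_of_le_toReal (not_le.1 hx).le


/-- **Lemma 3.2 (i)–(ii)**: if `w` is the `p`-torsion function of `Ω`
(encoded by the torsion energy identity), then for every `0 ≤ β ≤ (p-1)/p` the
integral `∫_Ω |∇w|^p w^{βp-p}` diverges; in particular `w^β ∉ W^{1,p}(Ω)` for
`0 < β ≤ (p-1)/p` and `log w ∉ W^{1,p}(Ω)` (case `β = 0`). -/
theorem torsion_power_not_sobolev
    (N : ℕ) (hN : 1 ≤ N) (p : ℝ) (hp : 1 < p)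
    (Ω : Set (EuclideanSpace ℝ (Fin N))) (hΩ : IsOpen Ω)
    (w : EuclideanSpace ℝ (Fin N) → ℝ)
    (hw0 : ∀ x ∈ Ω, 0 ≤ w x)
    (hwC1 : ContDiffOn ℝ 1 w Ω)
    (hwL1 : IntegrableOn w Ω)
    (hwLinf : essSup (fun x => ENNReal.ofReal (w x)) (volume.restrict Ω) < ⊤)
    (hwpos : 0 < essSup (fun x => ENNReal.ofReal (w x)) (volume.restrict Ω))
    (hTEI : ∀ ψ : ℝ → ℝ, ContDiff ℝ 1 ψ → ψ 0 = 0 → (∃ M : ℝ, ∀ t, |deriv ψ t| ≤ M) →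
      IntegrableOn (fun x => deriv ψ (w x) * ‖gradient w x‖ ^ p) Ω ∧
      IntegrableOn (fun x => ψ (w x)) Ω ∧
      ∫ x in Ω, deriv ψ (w x) * ‖gradient w x‖ ^ p = ∫ x in Ω, ψ (w x)) :
    ∀ β : ℝ, 0 ≤ β → β ≤ (p - 1) / p →
      ∫⁻ x in Ω, ENNReal.ofReal (‖gradient w x‖ ^ p * w x ^ (β * p - p)) = ⊤ := by
  intro β _ hβ
  have hp0 : 0 < p := by linarith
  have hr : β * p - p ≤ -1 := by
    rw [le_div_iff₀ hp0] at hβ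
    linarith
  set μ := volume.restrict Ω
  set M := (essSup (fun x => ENNReal.ofReal (w x)) μ).toReal
  have hM : 0 ≤ M := ENNReal.toReal_nonneg
  have hwM : ∀ᵐ x ∂μ, w x ≤ M := by
    filter_upwards [ENNReal.ae_le_essSup (μ := μ) (fun x => ENNReal.ofReal (w x))] with x hx
    exact (ENNReal.ofReal_le_iff_le_toReal hwLinf.ne).1 hx
  have hmem : ∀ᵐ x ∂μ, x ∈ Ω := ae_restrict_mem hΩ.measurableSet
  obtain ⟨δ, hδ, hm⟩ := exists_pos_measure_ge_ne_zero hwpos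
  by_contra hI
  set C := ENNReal.ofReal (M ^ (-1 - (β * p - p)))
  set I := ∫⁻ x, ENNReal.ofReal (‖gradient w x‖ ^ p * w x ^ (β * p - p)) ∂μ
  have hbound : ∀ n : ℕ, n * μ {x | δ ≤ w x} ≤ C * I := by
    intro n
    obtain ⟨k, hk, hkδ⟩ : ∃ k : ℝ, 0 ≤ k ∧ arsinh (k * δ) = n :=
      ⟨sinh n / δ, div_nonneg (sinh_nonneg_iff.2 n.cast_nonneg) hδ.le, by
        rw [div_mul_cancel₀ _ hδ.ne', arsinh_sinh]⟩
    obtain ⟨hint, hint', heq⟩ := hTEI (fun t => arsinh (k * t))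
      (contDiff_const.mul contDiff_id).arsinh (by simp)
      ⟨|k|, abs_deriv_arsinh_const_mul_le k⟩
    have hψ0 : ∀ᵐ x ∂μ, 0 ≤ arsinh (k * w x) := by
      filter_upwards [hmem] with x hx
      exact arsinh_nonneg_iff.2 (mul_nonneg hk (hw0 x hx))
    have hg0 : ∀ x, 0 ≤ deriv (fun t => arsinh (k * t)) (w x) * ‖gradient w x‖ ^ p := fun x =>
      mul_nonneg (deriv_arsinh_const_mul_nonneg hk _) (by positivity)
    calc n * μ {x | δ ≤ w x}
        ≤ n * μ {x | (n : ℝ≥0∞) ≤ ENNReal.ofReal (arsinh (k * w x))} := by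
          gcongr with x
          intro hx
          rw [← ENNReal.ofReal_natCast, ← hkδ]
          exact ENNReal.ofReal_le_ofReal (arsinh_le_arsinh.2 (by gcongr))
      _ ≤ ∫⁻ x, ENNReal.ofReal (arsinh (k * w x)) ∂μ :=
          mul_meas_ge_le_lintegral₀ hint'.aestronglyMeasurable.aemeasurable.ennreal_ofReal _
      _ = ∫⁻ x, ENNReal.ofReal (deriv (fun t => arsinh (k * t)) (w x) * ‖gradient w x‖ ^ p) ∂μ := by
          rw [← ofReal_integral_eq_lintegral_ofReal hint' hψ0, ← heq,
            ofReal_integral_eq_lintegral_ofReal hint (Eventually.of_forall hg0)]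
      _ ≤ ∫⁻ x, C * ENNReal.ofReal (‖gradient w x‖ ^ p * w x ^ (β * p - p)) ∂μ := by
          refine lintegral_mono_ae ?_
          filter_upwards [hmem, hwM] with x hx hxM
          rw [← ENNReal.ofReal_mul (by positivity)]
          refine ENNReal.ofReal_le_ofReal ?_
          rcases (hw0 x hx).eq_or_lt with h0 | hpos
          · simp [gradient_eq_zero_of_nonneg_of_eq_zero hΩ hw0 hx h0.symm,
              Real.zero_rpow hp0.ne']
          · calc _ ≤ (M ^ (-1 - (β * p - p)) * w x ^ (β * p - p)) * ‖gradient w x‖ ^ p := by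
                  gcongr
                  exact (deriv_arsinh_const_mul_le_inv k hpos).trans
                    (inv_le_rpow_mul_rpow hpos hxM hr)
              _ = _ := by ring
      _ = C * I := lintegral_const_mul' _ _ ENNReal.ofReal_ne_top
  obtain ⟨n, hn⟩ := ENNReal.exists_nat_mul_gt hm (ENNReal.mul_ne_top ENNReal.ofReal_ne_top hI)
  exact hn.not_ge (hbound n)
end

section
/- Let N ≥ 1, 1 < p < ∞, and let Ω ⊆ ℝ^N be an open set. Let w : Ω → [0,∞) be a function of class C^1(Ω) with w ∈ L^1(Ω) ∩ L^∞(Ω), satisfying the torsion energy identity. Then for every β with (p−1)/p < β < 1 such that ∫_Ω w^{βp−p+1} dx < ∞, one has ∫_Ω |∇w(x)|^p · w(x)^{βp−p} dx ≤ (βp−p+1)^{−1} · ∫_Ω w(x)^{βp−p+1} dx (the integrand on the left being interpreted as 0 at points where ∇w(x) = 0). Consequently ∫_Ω |∇(w^β)|^p dx ≤ β^p/(βp−p+1) · ∫_Ω w^{βp−p+1} dx. -/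
open MeasureTheory Real Filter
open scoped ENNReal Topology NNReal

/-- A primitive of the shifted power `(|t| + ε) ^ γ`, vanishing at `0`. -/
noncomputable def shiftedPowPrimitive (γ ε t : ℝ) : ℝ :=
  ∫ s in (0 : ℝ)..t, (|s| + ε) ^ γ

lemma continuous_abs_add_rpow (γ : ℝ) {ε : ℝ} (hε : 0 < ε) :
    Continuous fun s : ℝ => (|s| + ε) ^ γ :=
  (continuous_abs.add continuous_const).rpow_const fun s =>
    Or.inl (add_pos_of_nonneg_of_pos (abs_nonneg s) hε).ne'

lemma deriv_shiftedPowPrimitive (γ : ℝ) {ε : ℝ} (hε : 0 < ε) :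
    deriv (shiftedPowPrimitive γ ε) = fun s => (|s| + ε) ^ γ :=
  funext fun t => (continuous_abs_add_rpow γ hε).deriv_integral _ 0 t

lemma contDiff_shiftedPowPrimitive (γ : ℝ) {ε : ℝ} (hε : 0 < ε) :
    ContDiff ℝ 1 (shiftedPowPrimitive γ ε) := by
  refine contDiff_one_iff_deriv.2 ⟨fun t => ?_, ?_⟩
  · exact ((continuous_abs_add_rpow γ hε).integral_hasStrictDerivAt 0 t).hasDerivAt.differentiableAt
  · rw [deriv_shiftedPowPrimitive γ hε]
    exact continuous_abs_add_rpow γ hε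

lemma shiftedPowPrimitive_le {γ ε t : ℝ} (hγ : -1 < γ) (hγ0 : γ ≤ 0) (hε : 0 < ε) (ht : 0 ≤ t) :
    shiftedPowPrimitive γ ε t ≤ (γ + 1)⁻¹ * t ^ (γ + 1) := by
  have hle : shiftedPowPrimitive γ ε t ≤ ∫ s in (0 : ℝ)..t, s ^ γ := by
    refine intervalIntegral.integral_mono_on_of_le_Ioo ht
      ((continuous_abs_add_rpow γ hε).intervalIntegrable 0 t)
      (intervalIntegral.intervalIntegrable_rpow' hγ) fun s hs => ?_
    rw [abs_of_pos hs.1]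
    exact rpow_le_rpow_of_nonpos hs.1 (by linarith) hγ0
  refine hle.trans_eq ?_
  rw [integral_rpow (Or.inl hγ), zero_rpow (by linarith), sub_zero, div_eq_inv_mul]

/-- At a point of an open set where a nonnegative function vanishes, any positive power of it has
zero gradient (also when the gradient only has its default value). -/
lemma gradient_rpow_eq_zero {E : Type*} [NormedAddCommGroup E] [InnerProductSpace ℝ E]
    [CompleteSpace E] {Ω : Set E} (hΩ : IsOpen Ω) {w : E → ℝ} (hw : ∀ x ∈ Ω, 0 ≤ w x)
    {β : ℝ} (hβ : 0 < β) {x : E} (hx : x ∈ Ω) (hwx : w x = 0) :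
    gradient (fun y => w y ^ β) x = 0 := by
  have hmin : IsLocalMin (fun y => w y ^ β) x := by
    filter_upwards [hΩ.mem_nhds hx] with y hy
    simpa [hwx, zero_rpow hβ.ne'] using rpow_nonneg (hw y hy) β
  simp [gradient, hmin.fderiv_eq_zero]

lemma gradient_rpow {E : Type*} [NormedAddCommGroup E] [InnerProductSpace ℝ E]
    [CompleteSpace E] {w : E → ℝ} {x : E} (hd : DifferentiableAt ℝ w x) (hwx : w x ≠ 0) (β : ℝ) :
    gradient (fun y => w y ^ β) x = (β * w x ^ (β - 1)) • gradient w x := by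
  simp [gradient, (hd.hasFDerivAt.rpow_const (Or.inl hwx)).fderiv]

lemma norm_gradient_rpow_rpow_le {E : Type*} [NormedAddCommGroup E] [InnerProductSpace ℝ E]
    [CompleteSpace E] {Ω : Set E} (hΩ : IsOpen Ω) {w : E → ℝ} (hw : ∀ x ∈ Ω, 0 ≤ w x)
    (hd : DifferentiableOn ℝ w Ω) {β p : ℝ} (hβ : 0 < β) (hp : 0 < p) {x : E} (hx : x ∈ Ω) :
    ‖gradient (fun y => w y ^ β) x‖ ^ p ≤
      β ^ p * (‖gradient w x‖ ^ p * w x ^ (β * p - p)) := by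
  rcases (hw x hx).eq_or_lt with h0 | h0
  · rw [gradient_rpow_eq_zero hΩ hw hβ hx h0.symm, norm_zero, zero_rpow hp.ne']
    have := hw x hx
    positivity
  · rw [gradient_rpow (hd.differentiableAt (hΩ.mem_nhds hx)) h0.ne', norm_smul, Real.norm_eq_abs,
      abs_of_pos (by positivity), mul_rpow (by positivity) (norm_nonneg _),
      mul_rpow hβ.le (by positivity), ← rpow_mul h0.le, sub_mul, one_mul]
    exact le_of_eq (by ring)

/-- **Lemma 3.2 (iii)**: if `w` is the `p`-torsion function of `Ω`
(encoded by the torsion energy identity) and `(p-1)/p < β < 1` is such that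
`w^{βp-p+1} ∈ L^1(Ω)`, then
`∫_Ω |∇w|^p w^{βp-p} ≤ (βp-p+1)⁻¹ ∫_Ω w^{βp-p+1}` and consequently
`∫_Ω |∇(w^β)|^p ≤ β^p/(βp-p+1) ∫_Ω w^{βp-p+1}`. -/
theorem torsion_power_sobolev
    (N : ℕ) (hN : 1 ≤ N) (p : ℝ) (hp : 1 < p)
    (Ω : Set (EuclideanSpace ℝ (Fin N))) (hΩ : IsOpen Ω)
    (w : EuclideanSpace ℝ (Fin N) → ℝ)
    (hw0 : ∀ x ∈ Ω, 0 ≤ w x)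
    (hwC1 : ContDiffOn ℝ 1 w Ω)
    (hwL1 : IntegrableOn w Ω)
    (hwLinf : essSup (fun x => ENNReal.ofReal (w x)) (volume.restrict Ω) < ⊤)
    (hTEI : ∀ ψ : ℝ → ℝ, ContDiff ℝ 1 ψ → ψ 0 = 0 → (∃ M : ℝ, ∀ t, |deriv ψ t| ≤ M) →
      IntegrableOn (fun x => deriv ψ (w x) * ‖gradient w x‖ ^ p) Ω ∧
      IntegrableOn (fun x => ψ (w x)) Ω ∧
      ∫ x in Ω, deriv ψ (w x) * ‖gradient w x‖ ^ p = ∫ x in Ω, ψ (w x)) :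
    ∀ β : ℝ, (p - 1) / p < β → β < 1 →
      IntegrableOn (fun x => w x ^ (β * p - p + 1)) Ω →
      (∫⁻ x in Ω, ENNReal.ofReal (‖gradient w x‖ ^ p * w x ^ (β * p - p)))
          ≤ ENNReal.ofReal ((β * p - p + 1)⁻¹ * ∫ x in Ω, w x ^ (β * p - p + 1))
        ∧ (∫⁻ x in Ω, ENNReal.ofReal (‖gradient (fun y => w y ^ β) x‖ ^ p))
          ≤ ENNReal.ofReal (β ^ p / (β * p - p + 1) * ∫ x in Ω, w x ^ (β * p - p + 1)) := by
  intro β hβ hβ1 hint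
  have hp0 : 0 < p := by linarith
  have hβ0 : 0 < β := lt_trans (div_pos (by linarith) hp0) hβ
  rw [div_lt_iff₀ hp0] at hβ
  obtain ⟨γ, hγ⟩ : ∃ γ, γ = β * p - p := ⟨_, rfl⟩
  have hγ1 : -1 < γ := by linarith
  have hγ0 : γ < 0 := by nlinarith
  rw [← hγ] at hint ⊢
  have hmem : ∀ᵐ x ∂volume.restrict Ω, x ∈ Ω := ae_restrict_mem hΩ.measurableSet
  have hreg : ∀ ε : ℝ, 0 < ε →
      AEMeasurable (fun x => ENNReal.ofReal ((|w x| + ε) ^ γ * ‖gradient w x‖ ^ p))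
        (volume.restrict Ω) ∧
      ∫⁻ x in Ω, ENNReal.ofReal ((|w x| + ε) ^ γ * ‖gradient w x‖ ^ p) ≤
        ENNReal.ofReal ((γ + 1)⁻¹ * ∫ x in Ω, w x ^ (γ + 1)) := by
    intro ε hε
    obtain ⟨hI, hJ, heq⟩ := hTEI (shiftedPowPrimitive γ ε) (contDiff_shiftedPowPrimitive γ hε)
      (by simp [shiftedPowPrimitive]) ⟨ε ^ γ, fun t => by
        rw [deriv_shiftedPowPrimitive γ hε, abs_of_nonneg (by positivity)]
        exact rpow_le_rpow_of_nonpos hε (by linarith [abs_nonneg t]) hγ0.le⟩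
    simp only [deriv_shiftedPowPrimitive γ hε] at hI heq
    refine ⟨hI.aestronglyMeasurable.aemeasurable.ennreal_ofReal, ?_⟩
    rw [← ofReal_integral_eq_lintegral_ofReal hI (ae_of_all _ fun x => by positivity), heq,
      ← integral_const_mul]
    refine ENNReal.ofReal_le_ofReal (integral_mono_ae hJ (hint.const_mul _) ?_)
    filter_upwards [hmem] with x hx
    exact shiftedPowPrimitive_le hγ1 hγ0.le hε (hw0 x hx)
  have hfirst : ∫⁻ x in Ω, ENNReal.ofReal (‖gradient w x‖ ^ p * w x ^ γ) ≤
      ENNReal.ofReal ((γ + 1)⁻¹ * ∫ x in Ω, w x ^ (γ + 1)) := by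
    let F : ℕ → EuclideanSpace ℝ (Fin N) → ℝ≥0∞ := fun n x =>
      ENNReal.ofReal ((|w x| + 1 / ((n : ℝ) + 1)) ^ γ * ‖gradient w x‖ ^ p)
    calc ∫⁻ x in Ω, ENNReal.ofReal (‖gradient w x‖ ^ p * w x ^ γ)
        ≤ ∫⁻ x in Ω, liminf (fun n => F n x) atTop := by
          refine lintegral_mono_ae ?_
          filter_upwards [hmem] with x hx
          rcases (hw0 x hx).eq_or_lt with h0 | h0
          · simp [← h0, zero_rpow hγ0.ne]
          · have hbase : Tendsto (fun n : ℕ => |w x| + 1 / ((n : ℝ) + 1)) atTop (𝓝 (w x)) := by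
              simpa [abs_of_pos h0] using
                (tendsto_one_div_add_atTop_nhds_zero_nat (𝕜 := ℝ)).const_add |w x|
            have hlim : Tendsto (fun n => F n x) atTop
                (𝓝 (ENNReal.ofReal (w x ^ γ * ‖gradient w x‖ ^ p))) :=
              ENNReal.tendsto_ofReal ((hbase.rpow_const (Or.inl h0.ne')).mul_const _)
            rw [hlim.liminf_eq, mul_comm]
      _ ≤ liminf (fun n => ∫⁻ x in Ω, F n x) atTop :=
          lintegral_liminf_le' fun n => (hreg _ Nat.one_div_pos_of_nat).1
      _ ≤ liminf (fun _ : ℕ => ENNReal.ofReal ((γ + 1)⁻¹ * ∫ x in Ω, w x ^ (γ + 1))) atTop :=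
          liminf_le_liminf (Eventually.of_forall fun n => (hreg _ Nat.one_div_pos_of_nat).2)
      _ = _ := liminf_const _
  refine ⟨hfirst, ?_⟩
  calc ∫⁻ x in Ω, ENNReal.ofReal (‖gradient (fun y => w y ^ β) x‖ ^ p)
      ≤ ∫⁻ x in Ω, ENNReal.ofReal (β ^ p) * ENNReal.ofReal (‖gradient w x‖ ^ p * w x ^ γ) := by
        refine lintegral_mono_ae ?_
        filter_upwards [hmem] with x hx
        rw [← ENNReal.ofReal_mul (by positivity), hγ]
        exact ENNReal.ofReal_le_ofReal (norm_gradient_rpow_rpow_le hΩ hw0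
          (hwC1.differentiableOn one_ne_zero) hβ0 hp0 hx)
    _ = ENNReal.ofReal (β ^ p) * ∫⁻ x in Ω, ENNReal.ofReal (‖gradient w x‖ ^ p * w x ^ γ) :=
        lintegral_const_mul' _ _ ENNReal.ofReal_ne_top
    _ ≤ ENNReal.ofReal (β ^ p) * ENNReal.ofReal ((γ + 1)⁻¹ * ∫ x in Ω, w x ^ (γ + 1)) := by
        gcongr
    _ = ENNReal.ofReal (β ^ p / (γ + 1) * ∫ x in Ω, w x ^ (γ + 1)) := by
        rw [← ENNReal.ofReal_mul (by positivity), ← mul_assoc, div_eq_mul_inv]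
end

section
/- Let N ≥ 1, 1 < p < ∞, and let Ω ⊆ ℝ^N be an open set with 0 < |Ω| < ∞. Let w : Ω → (0,∞) be a function of class C^1(Ω) with w ∈ L^1(Ω) ∩ L^∞(Ω), satisfying the torsion energy identity. For each integer n ≥ 1 set u_n := w^{(p−1)/p + 1/n} and define the quotient Q_n := ( ∫_Ω |∇u_n|^p dx ) / ( ∫_Ω [ |∇w|^p/w^p + (p/(p−1)) w^{1−p} ] u_n^p dx ). Then for every n ≥ 1 the denominator is a positive finite real number, ((p−1)/p)^p ≤ Q_n ≤ ((p−1)/p + 1/n)^p, and consequently Q_n → ((p−1)/p)^p as n → ∞; in particular, the constant ((p−1)/p)^p in the torsional Hardy inequality cannot be replaced by any larger constant. -/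
open MeasureTheory Real Filter
open scoped ENNReal Topology NNReal

/-- The real function `F` on `[0, M]` extends to a `C¹` test function whose derivative is the
continuous bounded function `G`. -/
theorem exists_contDiff_primitive {F G : ℝ → ℝ} {M B : ℝ} (hG : Continuous G)
    (hB : ∀ t, |G t| ≤ B) (hF : ContinuousOn F (Set.Icc 0 M)) (hF0 : F 0 = 0)
    (hFG : ∀ t ∈ Set.Ioo 0 M, HasDerivAt F (G t) t) :
    ∃ ψ : ℝ → ℝ, ContDiff ℝ 1 ψ ∧ ψ 0 = 0 ∧ (∃ C : ℝ, ∀ t, |deriv ψ t| ≤ C) ∧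
      deriv ψ = G ∧ Set.EqOn ψ F (Set.Icc 0 M) := by
  have hd : deriv (fun t => ∫ u in (0 : ℝ)..t, G u) = G :=
    funext fun t => hG.deriv_integral G 0 t
  refine ⟨fun t => ∫ u in (0 : ℝ)..t, G u, ?_, by simp, ⟨B, fun t => by rw [hd]; exact hB t⟩, hd, ?_⟩
  · rw [contDiff_one_iff_deriv, hd]
    exact ⟨fun t => (hG.integral_hasStrictDerivAt 0 t).hasDerivAt.differentiableAt, hG⟩
  · intro t ht
    have h := intervalIntegral.integral_eq_sub_of_hasDerivAt_of_le ht.1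
      (hF.mono (Set.Icc_subset_Icc_right ht.2))
      (fun u hu => hFG u ⟨hu.1, hu.2.trans_le ht.2⟩) (hG.intervalIntegrable 0 t)
    simpa [hF0] using h

section EnergyIdentity

variable {X : Type*} [MeasurableSpace X] {μ : Measure X} {w g : X → ℝ} {M s : ℝ}

theorem integrable_rpow_of_ae_le [IsFiniteMeasure μ] (hw : AEStronglyMeasurable w μ)
    (hpos : ∀ᵐ x ∂μ, 0 < w x) (hM : ∀ᵐ x ∂μ, w x ≤ M) (hs : 0 < s) :
    Integrable (fun x => w x ^ s) μ := by
  refine Integrable.of_bound (hw.aemeasurable.pow_const s).aestronglyMeasurable (M ^ s) ?_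
  filter_upwards [hpos, hM] with x h0 h1
  rw [Real.norm_of_nonneg (by positivity)]
  gcongr

/-- The energy identity holds for a primitive `F` which is only controlled on `[0, M]`. -/
theorem energy_identity_of_primitive
    (hpos : ∀ᵐ x ∂μ, 0 < w x) (hM : ∀ᵐ x ∂μ, w x ≤ M)
    (hE : ∀ ψ : ℝ → ℝ, ContDiff ℝ 1 ψ → ψ 0 = 0 → (∃ C : ℝ, ∀ t, |deriv ψ t| ≤ C) →
      Integrable (fun x => deriv ψ (w x) * g x) μ ∧ Integrable (fun x => ψ (w x)) μ ∧
      ∫ x, deriv ψ (w x) * g x ∂μ = ∫ x, ψ (w x) ∂μ)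
    {F G : ℝ → ℝ} {B : ℝ} (hG : Continuous G)
    (hB : ∀ t, |G t| ≤ B) (hF : ContinuousOn F (Set.Icc 0 M)) (hF0 : F 0 = 0)
    (hFG : ∀ t ∈ Set.Ioo 0 M, HasDerivAt F (G t) t) :
    Integrable (fun x => G (w x) * g x) μ ∧
      ∫ x, G (w x) * g x ∂μ = ∫ x, F (w x) ∂μ := by
  obtain ⟨ψ, h1, h2, h3, hd, hψ⟩ := exists_contDiff_primitive hG hB hF hF0 hFG
  obtain ⟨i1, -, e⟩ := hE ψ h1 h2 h3
  rw [hd] at i1 e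
  refine ⟨i1, e.trans (integral_congr_ae ?_)⟩
  filter_upwards [hpos, hM] with x hx0 hxM using hψ ⟨hx0.le, hxM⟩

/-- The energy identity for the power `t ^ s` with `s ≥ 1`. -/
theorem energy_identity_rpow_of_one_le
    (hpos : ∀ᵐ x ∂μ, 0 < w x) (hM : ∀ᵐ x ∂μ, w x ≤ M)
    (hE : ∀ ψ : ℝ → ℝ, ContDiff ℝ 1 ψ → ψ 0 = 0 → (∃ C : ℝ, ∀ t, |deriv ψ t| ≤ C) →
      Integrable (fun x => deriv ψ (w x) * g x) μ ∧ Integrable (fun x => ψ (w x)) μ ∧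
      ∫ x, deriv ψ (w x) * g x ∂μ = ∫ x, ψ (w x) ∂μ)
    (hM0 : 0 < M) (hs : 1 ≤ s) :
    Integrable (fun x => s * w x ^ (s - 1) * g x) μ ∧
      ∫ x, s * w x ^ (s - 1) * g x ∂μ = ∫ x, w x ^ s ∂μ := by
  have h := energy_identity_of_primitive (F := fun t => t ^ s)
    (G := fun t => s * (min (max t 0) M) ^ (s - 1)) (B := s * M ^ (s - 1)) hpos hM hE
    (continuous_const.mul (((continuous_id.max continuous_const).min
      continuous_const).rpow_const fun _ => Or.inr (by linarith)))
    (fun t => by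
      have h0 : 0 ≤ min (max t 0) M := le_min (le_max_right _ _) hM0.le
      rw [abs_of_nonneg (by positivity)]
      exact mul_le_mul_of_nonneg_left
        (Real.rpow_le_rpow h0 (min_le_right _ _) (by linarith)) (by linarith))
    (Real.continuous_rpow_const (by linarith)).continuousOn
    (Real.zero_rpow (by linarith))
    (fun t ht => by
      rw [max_eq_left ht.1.le, min_eq_left ht.2.le]
      exact Real.hasDerivAt_rpow_const (Or.inl ht.1.ne'))
  have hae : (fun x => s * (min (max (w x) 0) M) ^ (s - 1) * g x) =ᵐ[μ]
      fun x => s * w x ^ (s - 1) * g x := by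
    filter_upwards [hpos, hM] with x h0 h1
    rw [max_eq_left h0.le, min_eq_left h1]
  exact ⟨h.1.congr hae, (integral_congr_ae hae).symm.trans h.2⟩

/-- The energy identity for the power `t ^ s` with `s < 1`, obtained as a monotone limit of the
identities for `(t + ε) ^ s - ε ^ s`. -/
theorem energy_identity_rpow_of_lt_one [IsFiniteMeasure μ] (hw : AEStronglyMeasurable w μ)
    (hpos : ∀ᵐ x ∂μ, 0 < w x) (hM : ∀ᵐ x ∂μ, w x ≤ M)
    (hg : AEStronglyMeasurable g μ) (hg0 : ∀ x, 0 ≤ g x)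
    (hE : ∀ ψ : ℝ → ℝ, ContDiff ℝ 1 ψ → ψ 0 = 0 → (∃ C : ℝ, ∀ t, |deriv ψ t| ≤ C) →
      Integrable (fun x => deriv ψ (w x) * g x) μ ∧ Integrable (fun x => ψ (w x)) μ ∧
      ∫ x, deriv ψ (w x) * g x ∂μ = ∫ x, ψ (w x) ∂μ)
    (hs : 0 < s) (hs1 : s < 1) :
    Integrable (fun x => s * w x ^ (s - 1) * g x) μ ∧
      ∫ x, s * w x ^ (s - 1) * g x ∂μ = ∫ x, w x ^ s ∂μ := by
  let ε : ℕ → ℝ := fun k => 1 / ((k : ℝ) + 1)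
  have hε : ∀ k, 0 < ε k := fun k => Nat.one_div_pos_of_nat
  have hεlim : Tendsto ε atTop (𝓝 0) := tendsto_one_div_add_atTop_nhds_zero_nat
  let G : ℕ → ℝ → ℝ := fun k t => s * (max t 0 + ε k) ^ (s - 1)
  have hbase : ∀ k t, 0 < max t 0 + ε k := fun k t =>
    add_pos_of_nonneg_of_pos (le_max_right _ _) (hε k)
  have hG0 : ∀ k t, 0 ≤ G k t := fun k t => mul_nonneg hs.le (Real.rpow_nonneg (hbase k t).le _)
  have key : ∀ k, Integrable (fun x => G k (w x) * g x) μ ∧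
      ∫ x, G k (w x) * g x ∂μ = ∫ x, ((w x + ε k) ^ s - ε k ^ s) ∂μ := by
    intro k
    refine energy_identity_of_primitive (F := fun t => (t + ε k) ^ s - ε k ^ s) (G := G k)
      (B := s * ε k ^ (s - 1)) hpos hM hE
      (continuous_const.mul (((continuous_id.max continuous_const).add
        continuous_const).rpow_const fun t => Or.inl (hbase k t).ne')) ?_ ?_ (by simp) ?_
    · intro t
      rw [abs_of_nonneg (hG0 k t)]
      exact mul_le_mul_of_nonneg_left (Real.rpow_le_rpow_of_nonpos (hε k)
        (le_add_of_nonneg_left (le_max_right _ _)) (by linarith)) hs.le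
    · exact (((continuous_id.add continuous_const).rpow_const
        fun _ => Or.inr hs.le).sub continuous_const).continuousOn
    · intro t ht
      have h := ((hasDerivAt_id t).add_const (ε k)).rpow_const (p := s)
        (Or.inl (by have := ht.1; have := hε k; simp only [id]; positivity))
      simpa [G, max_eq_left ht.1.le] using h.sub_const (ε k ^ s)
  have hlim : Tendsto (fun k => ∫ x, ((w x + ε k) ^ s - ε k ^ s) ∂μ) atTop
      (𝓝 (∫ x, w x ^ s ∂μ)) := by
    refine tendsto_integral_of_dominated_convergence (fun x => w x ^ s)
      (fun k => (((hw.aemeasurable.add_const _).pow_const s).sub_const _).aestronglyMeasurable)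
      (integrable_rpow_of_ae_le hw hpos hM hs) (fun k => ?_) ?_
    · filter_upwards [hpos] with x hx
      have h1 : ε k ^ s ≤ (w x + ε k) ^ s :=
        Real.rpow_le_rpow (hε k).le (by linarith) hs.le
      have h2 := Real.rpow_add_le_add_rpow hx.le (hε k).le hs.le hs1.le
      rw [Real.norm_of_nonneg (by linarith)]
      linarith
    · filter_upwards [hpos] with x hx
      have h1 : Tendsto (fun k => (w x + ε k) ^ s) atTop (𝓝 ((w x + 0) ^ s)) :=
        (hεlim.const_add (w x)).rpow_const (Or.inr hs.le)
      have h2 : Tendsto (fun k => ε k ^ s) atTop (𝓝 (0 ^ s)) :=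
        hεlim.rpow_const (Or.inr hs.le)
      simpa [Real.zero_rpow hs.ne'] using h1.sub h2
  have hmeas : AEStronglyMeasurable (fun x => s * w x ^ (s - 1) * g x) μ :=
    (((hw.aemeasurable.pow_const (s - 1)).const_mul s).mul hg.aemeasurable).aestronglyMeasurable
  have hnonneg : 0 ≤ᵐ[μ] fun x => s * w x ^ (s - 1) * g x := by
    filter_upwards [hpos] with x hx
    exact mul_nonneg (by positivity) (hg0 x)
  have hlin : Tendsto (fun k => ∫⁻ x, ENNReal.ofReal (G k (w x) * g x) ∂μ) atTop
      (𝓝 (∫⁻ x, ENNReal.ofReal (s * w x ^ (s - 1) * g x) ∂μ)) := by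
    refine lintegral_tendsto_of_tendsto_of_monotone
      (fun k => (key k).1.aemeasurable.ennreal_ofReal) (ae_of_all _ fun x k l hkl => ?_) ?_
    · refine ENNReal.ofReal_le_ofReal (mul_le_mul_of_nonneg_right (mul_le_mul_of_nonneg_left
        (Real.rpow_le_rpow_of_nonpos (hbase l _) ?_ (by linarith)) hs.le) (hg0 x))
      exact add_le_add_right (Nat.one_div_le_one_div hkl) _
    · filter_upwards [hpos] with x hx
      refine (ENNReal.continuous_ofReal.tendsto _).comp (Tendsto.mul_const _ ?_)
      have h : Tendsto (fun k => (max (w x) 0 + ε k) ^ (s - 1)) atTop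
          (𝓝 ((max (w x) 0 + 0) ^ (s - 1))) :=
        (hεlim.const_add _).rpow_const (Or.inl (by simp [hx.le, hx.ne']))
      simpa [G, max_eq_left hx.le] using h.const_mul s
  have hlin' : ∀ k, ∫⁻ x, ENNReal.ofReal (G k (w x) * g x) ∂μ =
      ENNReal.ofReal (∫ x, ((w x + ε k) ^ s - ε k ^ s) ∂μ) := fun k => by
    rw [← (key k).2, ofReal_integral_eq_lintegral_ofReal (key k).1
      (ae_of_all _ fun x => mul_nonneg (hG0 k _) (hg0 x))]
  simp only [hlin'] at hlin
  have heq := tendsto_nhds_unique hlin ((ENNReal.continuous_ofReal.tendsto _).comp hlim)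
  refine ⟨⟨hmeas, ?_⟩, ?_⟩
  · rw [hasFiniteIntegral_iff_ofReal hnonneg, heq]
    exact ENNReal.ofReal_lt_top
  · rw [integral_eq_lintegral_of_nonneg_ae hnonneg hmeas, heq, ENNReal.toReal_ofReal]
    refine integral_nonneg_of_ae ?_
    filter_upwards [hpos] with x hx
    exact Real.rpow_nonneg hx.le s

/-- The energy identity for all positive powers `t ^ s`. -/
theorem energy_identity_rpow [IsFiniteMeasure μ] (hw : AEStronglyMeasurable w μ)
    (hpos : ∀ᵐ x ∂μ, 0 < w x) (hM0 : 0 < M) (hM : ∀ᵐ x ∂μ, w x ≤ M) (hg0 : ∀ x, 0 ≤ g x)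
    (hE : ∀ ψ : ℝ → ℝ, ContDiff ℝ 1 ψ → ψ 0 = 0 → (∃ C : ℝ, ∀ t, |deriv ψ t| ≤ C) →
      Integrable (fun x => deriv ψ (w x) * g x) μ ∧ Integrable (fun x => ψ (w x)) μ ∧
      ∫ x, deriv ψ (w x) * g x ∂μ = ∫ x, ψ (w x) ∂μ)
    (hs : 0 < s) :
    Integrable (fun x => w x ^ (s - 1) * g x) μ ∧
      s * ∫ x, w x ^ (s - 1) * g x ∂μ = ∫ x, w x ^ s ∂μ := by
  have hg : AEStronglyMeasurable g μ := by
    simpa using (energy_identity_rpow_of_one_le hpos hM hE hM0 le_rfl).1.aestronglyMeasurable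
  have h : Integrable (fun x => s * w x ^ (s - 1) * g x) μ ∧
      ∫ x, s * w x ^ (s - 1) * g x ∂μ = ∫ x, w x ^ s ∂μ := by
    rcases le_or_gt 1 s with h1 | h1
    · exact energy_identity_rpow_of_one_le hpos hM hE hM0 h1
    · exact energy_identity_rpow_of_lt_one hw hpos hM hg hg0 hE hs h1
  simp only [mul_assoc, integral_const_mul] at h
  exact ⟨by simpa [hs.ne'] using h.1.const_mul s⁻¹, h.2⟩

end EnergyIdentity

/-- The norm of the gradient of a power of a positive function. -/
theorem norm_gradient_rpow {E : Type*} [NormedAddCommGroup E] [InnerProductSpace ℝ E]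
    [CompleteSpace E] {w : E → ℝ} {x : E} (hw : DifferentiableAt ℝ w x) (hx : 0 < w x)
    {a : ℝ} (ha : 0 ≤ a) :
    ‖gradient (fun y => w y ^ a) x‖ = a * w x ^ (a - 1) * ‖gradient w x‖ := by
  have h := hw.hasFDerivAt.rpow_const (p := a) (Or.inl hx.ne')
  simp only [gradient, LinearIsometryEquiv.norm_map, h.fderiv, norm_smul]
  rw [Real.norm_of_nonneg (by positivity)]

theorem exists_pos_ae_le_of_essSup_lt_top {X : Type*} [MeasurableSpace X] {μ : Measure X}
    {w : X → ℝ} (h : essSup (fun x => ENNReal.ofReal (w x)) μ < ⊤) :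
    ∃ M : ℝ, 0 < M ∧ ∀ᵐ x ∂μ, w x ≤ M := by
  refine ⟨(essSup (fun x => ENNReal.ofReal (w x)) μ).toReal + 1, by positivity, ?_⟩
  filter_upwards [ENNReal.ae_le_essSup fun x => ENNReal.ofReal (w x)] with x hx
  exact ((ENNReal.ofReal_le_iff_le_toReal h.ne).1 hx).trans (by linarith)

/-- **Sharpness of the borderline torsional Hardy inequality** (Proposition 6.4).
Let `Ω` have finite positive measure and let `w > 0` be its `p`-torsion function
(encoded by the torsion energy identity). With `u_n = w^{(p-1)/p + 1/n}` and
`Q_n = (∫_Ω |∇u_n|^p) / (∫_Ω [|∇w|^p/w^p + (p/(p-1)) w^{1-p}] u_n^p)`, for every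
`n ≥ 1` the denominator is a positive finite real number,
`((p-1)/p)^p ≤ Q_n ≤ ((p-1)/p + 1/n)^p`, and `Q_n → ((p-1)/p)^p`. -/
theorem torsional_hardy_borderline_sharp
    (N : ℕ) (hN : 1 ≤ N) (p : ℝ) (hp : 1 < p)
    (Ω : Set (EuclideanSpace ℝ (Fin N))) (hΩ : IsOpen Ω)
    (hΩ0 : volume Ω ≠ 0) (hΩfin : volume Ω < ⊤)
    (w : EuclideanSpace ℝ (Fin N) → ℝ)
    (hwpos : ∀ x ∈ Ω, 0 < w x)
    (hwC1 : ContDiffOn ℝ 1 w Ω)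
    (hwL1 : IntegrableOn w Ω)
    (hwLinf : essSup (fun x => ENNReal.ofReal (w x)) (volume.restrict Ω) < ⊤)
    (hTEI : ∀ ψ : ℝ → ℝ, ContDiff ℝ 1 ψ → ψ 0 = 0 → (∃ M : ℝ, ∀ t, |deriv ψ t| ≤ M) →
      IntegrableOn (fun x => deriv ψ (w x) * ‖gradient w x‖ ^ p) Ω ∧
      IntegrableOn (fun x => ψ (w x)) Ω ∧
      ∫ x in Ω, deriv ψ (w x) * ‖gradient w x‖ ^ p = ∫ x in Ω, ψ (w x)) :
    (∀ n : ℕ, 1 ≤ n →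
      IntegrableOn (fun x =>
        (‖gradient w x‖ ^ p / w x ^ p + (p / (p - 1)) * w x ^ (1 - p))
          * (w x ^ ((p - 1) / p + 1 / (n : ℝ))) ^ p) Ω ∧
      0 < ∫ x in Ω,
        (‖gradient w x‖ ^ p / w x ^ p + (p / (p - 1)) * w x ^ (1 - p))
          * (w x ^ ((p - 1) / p + 1 / (n : ℝ))) ^ p ∧
      ((p - 1) / p) ^ p ≤
        (∫ x in Ω, ‖gradient (fun y => w y ^ ((p - 1) / p + 1 / (n : ℝ))) x‖ ^ p) /
        (∫ x in Ω, (‖gradient w x‖ ^ p / w x ^ p + (p / (p - 1)) * w x ^ (1 - p))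
          * (w x ^ ((p - 1) / p + 1 / (n : ℝ))) ^ p) ∧
      (∫ x in Ω, ‖gradient (fun y => w y ^ ((p - 1) / p + 1 / (n : ℝ))) x‖ ^ p) /
        (∫ x in Ω, (‖gradient w x‖ ^ p / w x ^ p + (p / (p - 1)) * w x ^ (1 - p))
          * (w x ^ ((p - 1) / p + 1 / (n : ℝ))) ^ p)
        ≤ ((p - 1) / p + 1 / (n : ℝ)) ^ p)
    ∧ Tendsto (fun n : ℕ =>
        (∫ x in Ω, ‖gradient (fun y => w y ^ ((p - 1) / p + 1 / (n : ℝ))) x‖ ^ p) /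
        (∫ x in Ω, (‖gradient w x‖ ^ p / w x ^ p + (p / (p - 1)) * w x ^ (1 - p))
          * (w x ^ ((p - 1) / p + 1 / (n : ℝ))) ^ p))
        atTop (nhds (((p - 1) / p) ^ p)) := by
  have hp0 : 0 < p := by linarith
  have hp1 : 0 < p - 1 := by linarith
  have : IsFiniteMeasure (volume.restrict Ω) := ⟨by simpa using hΩfin⟩
  have hpos : ∀ᵐ x ∂volume.restrict Ω, 0 < w x :=
    (ae_restrict_iff' hΩ.measurableSet).2 (ae_of_all _ hwpos)
  obtain ⟨M, hM0, hM⟩ := exists_pos_ae_le_of_essSup_lt_top hwLinf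
  refine and_iff_left_of_imp (fun H => ?_) |>.2 fun n hn => ?_
  · have hlim : Tendsto (fun n : ℕ => ((p - 1) / p + 1 / (n : ℝ)) ^ p) atTop
        (𝓝 (((p - 1) / p) ^ p)) := by
      have h := (tendsto_one_div_atTop_nhds_zero_nat (𝕜 := ℝ)).const_add ((p - 1) / p)
      rw [add_zero] at h
      exact h.rpow_const (Or.inr hp0.le)
    refine tendsto_of_tendsto_of_tendsto_of_le_of_le' tendsto_const_nhds hlim ?_ ?_
    · filter_upwards [eventually_ge_atTop 1] with n hn using (H n hn).2.2.1
    · filter_upwards [eventually_ge_atTop 1] with n hn using (H n hn).2.2.2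
  have hn0 : (0 : ℝ) < n := by exact_mod_cast hn
  set a : ℝ := (p - 1) / p + 1 / (n : ℝ) with ha
  have ha0 : 0 < a := by positivity
  obtain ⟨s, hs⟩ : ∃ s : ℝ, s = p / n := ⟨_, rfl⟩
  have hs0 : 0 < s := by rw [hs]; positivity
  have hap : a * p = p - 1 + s := by rw [ha, hs]; field_simp
  obtain ⟨hint, heq⟩ := energy_identity_rpow hwL1.aestronglyMeasurable hpos hM0 hM
    (g := fun x => ‖gradient w x‖ ^ p) (fun x => by positivity) hTEI hs0
  have hints : IntegrableOn (fun x => w x ^ s) Ω :=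
    integrable_rpow_of_ae_le hwL1.aestronglyMeasurable hpos hM hs0
  have hspos : 0 < ∫ x in Ω, w x ^ s := by
    rw [setIntegral_pos_iff_support_of_nonneg_ae
      (hpos.mono fun x hx => Real.rpow_nonneg hx.le s) hints, Set.inter_eq_right.2]
    · exact pos_iff_ne_zero.2 hΩ0
    · exact fun x hx => (Real.rpow_pos_of_pos (hwpos x hx) s).ne'
  have hden : Set.EqOn (fun x => (‖gradient w x‖ ^ p / w x ^ p + (p / (p - 1)) * w x ^ (1 - p))
      * (w x ^ a) ^ p)
      (fun x => w x ^ (s - 1) * ‖gradient w x‖ ^ p + (p / (p - 1)) * w x ^ s) Ω := by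
    intro x hx
    have h := hwpos x hx
    have e1 : (w x ^ a) ^ p = w x ^ (s - 1) * w x ^ p := by
      rw [← Real.rpow_mul h.le, ← Real.rpow_add h, hap]
      congr 1
      ring
    have e2 : w x ^ (1 - p) * (w x ^ (s - 1) * w x ^ p) = w x ^ s := by
      rw [← Real.rpow_add h, ← Real.rpow_add h]
      congr 1
      ring
    have e3 : w x ^ p ≠ 0 := (Real.rpow_pos_of_pos h p).ne'
    simp only [e1]
    rw [add_mul, mul_assoc (p / (p - 1)), e2]
    congr 1
    field_simp
  have hnum : Set.EqOn (fun x => ‖gradient (fun y => w y ^ a) x‖ ^ p)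
      (fun x => a ^ p * (w x ^ (s - 1) * ‖gradient w x‖ ^ p)) Ω := by
    intro x hx
    have h := hwpos x hx
    have hdiff : DifferentiableAt ℝ w x :=
      (hwC1.differentiableOn one_ne_zero).differentiableAt (hΩ.mem_nhds hx)
    simp only
    rw [norm_gradient_rpow hdiff h ha0.le, Real.mul_rpow (by positivity) (by positivity),
      Real.mul_rpow ha0.le (by positivity), ← Real.rpow_mul h.le, mul_assoc,
      show (a - 1) * p = s - 1 by linarith]
  rw [setIntegral_congr_fun hΩ.measurableSet hden, setIntegral_congr_fun hΩ.measurableSet hnum,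
    integrableOn_congr_fun hden hΩ.measurableSet, integral_const_mul,
    integral_add hint (hints.const_mul _), integral_const_mul, ← heq]
  rw [← heq] at hspos
  set A : ℝ := ∫ x in Ω, w x ^ (s - 1) * ‖gradient w x‖ ^ p
  have hA : 0 < A := pos_of_mul_pos_right hspos hs0.le
  have hquot : a ^ p * A / (A + p / (p - 1) * (s * A)) = a ^ p / (1 + p * (s / (p - 1))) := by
    field_simp
  refine ⟨hint.add (hints.const_mul _), by positivity, ?_, ?_⟩
  · have hfac : a = (p - 1) / p * (1 + s / (p - 1)) := by
      rw [ha, hs]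
      field_simp
    rw [hquot, le_div_iff₀ (by positivity), hfac, Real.mul_rpow (by positivity) (by positivity)]
    have hB : -1 ≤ s / (p - 1) := by linarith [div_pos hs0 hp1]
    exact mul_le_mul_of_nonneg_left (one_add_mul_self_le_rpow_one_add hB hp.le) (by positivity)
  · rw [hquot]
    exact div_le_self (by positivity) (le_add_of_nonneg_right (by positivity))
end
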